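/- arXiv:math/9908022 — 3 statements merged into one kernel-verified Lean document; each statement's English description precedes it below -/
import Mathlib

section
/- Let (A, 𝔪) be a commutative Noetherian local ring with residue field k = A/𝔪, and let 0 → M_s → M_{s-1} → ⋯ → M_0 → 0 be a chain complex of (not necessarily finitely generated) A-modules concentrated in homological degrees 0,…,s such that every nonzero homology module H_i(M_•) has depth 0, i.e. Hom_A(k, H_i(M_•)) ≠ 0 whenever H_i(M_•) ≠ 0. If for every i with 0 ≤ i ≤ s one has Ext^j_A(k, M_i) = 0 for all j < i (that is, depth_A(M_i) ≥ i), then H_i(M_•) = 0 for all i > 0. -/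
open CategoryTheory CategoryTheory.Limits

universe w v u

namespace AcyclicityLemma

section Abelian

variable {C : Type u} [Category.{v} C] [Abelian C]

/-- The short exact sequence `0 → Bᵢ → Zᵢ → Hᵢ → 0`, where the boundaries `Bᵢ` are the kernel of
the projection from cycles to homology. -/
lemma shortExact_boundaries_cycles_homology (M : ChainComplex C ℕ) (i : ℕ) :
    (ShortComplex.mk (kernel.ι (M.homologyπ i)) (M.homologyπ i)
      (kernel.condition _)).ShortExact where
  exact := ShortComplex.exact_kernel _

/-- The short exact sequence `0 → Zᵢ₊₁ → Mᵢ₊₁ → Bᵢ → 0`, where the boundaries `Bᵢ` are the kernel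
of the projection from cycles to homology. -/
lemma exists_shortExact_cycles_X_boundaries (M : ChainComplex C ℕ) (i : ℕ) :
    ∃ (p : M.X (i + 1) ⟶ kernel (M.homologyπ i)) (hp : M.iCycles (i + 1) ≫ p = 0),
      (ShortComplex.mk (M.iCycles (i + 1)) p hp).ShortExact := by
  let p : M.X (i + 1) ⟶ kernel (M.homologyπ i) :=
    kernel.lift _ (M.toCycles (i + 1) i) (M.toCycles_comp_homologyπ _ _)
  have hpd : p ≫ kernel.ι (M.homologyπ i) ≫ M.iCycles i = M.d (i + 1) i := by simp [p]
  have hp : M.iCycles (i + 1) ≫ p = 0 := by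
    rw [← cancel_mono (kernel.ι (M.homologyπ i) ≫ M.iCycles i), Category.assoc, hpd]
    simp
  have hcoker := ShortComplex.exact_of_g_is_cokernel
    (ShortComplex.mk (M.toCycles (i + 1) i) (M.homologyπ i) (M.toCycles_comp_homologyπ _ _))
    (M.homologyIsCokernel (i + 1) i (by simp))
  have : Epi p := hcoker.epi_kernelLift
  refine ⟨p, hp, { exact := ?_ }⟩
  have hker := ShortComplex.exact_of_f_is_kernel
    (ShortComplex.mk (M.iCycles (i + 1)) (M.d (i + 1) i) (M.iCycles_d _ _))
    (M.cyclesIsKernel (i + 1) i (by simp))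
  let φ : ShortComplex.mk (M.iCycles (i + 1)) p hp ⟶
      ShortComplex.mk (M.iCycles (i + 1)) (M.d (i + 1) i) (M.iCycles_d _ _) :=
    { τ₁ := 𝟙 _
      τ₂ := 𝟙 _
      τ₃ := kernel.ι (M.homologyπ i) ≫ M.iCycles i
      comm₂₃ := by simp [hpd] }
  have : Epi φ.τ₁ := inferInstanceAs (Epi (𝟙 _))
  have : IsIso φ.τ₂ := inferInstanceAs (IsIso (𝟙 _))
  have : Mono φ.τ₃ := inferInstanceAs (Mono (kernel.ι (M.homologyπ i) ≫ M.iCycles i))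
  exact (ShortComplex.exact_iff_of_epi_of_isIso_of_mono φ).2 hker

variable [HasExt.{w} C]

lemma subsingleton_ext_of_isZero (W : C) {Y : C} (hY : IsZero Y) (n : ℕ) :
    Subsingleton (Abelian.Ext.{w} W Y n) :=
  subsingleton_of_forall_eq 0 fun x => by
    rw [← x.comp_mk₀_id, hY.eq_of_src (𝟙 Y) 0, Abelian.Ext.mk₀_zero, Abelian.Ext.comp_zero]

lemma subsingleton_ext_X₂ (W : C) {S : ShortComplex C} (hS : S.ShortExact) (n : ℕ)
    (h₁ : Subsingleton (Abelian.Ext.{w} W S.X₁ n))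
    (h₃ : Subsingleton (Abelian.Ext.{w} W S.X₃ n)) :
    Subsingleton (Abelian.Ext.{w} W S.X₂ n) :=
  subsingleton_of_forall_eq 0 fun x => by
    obtain ⟨y, rfl⟩ := Abelian.Ext.covariant_sequence_exact₂ W hS x (Subsingleton.elim _ _)
    rw [Subsingleton.elim y 0, Abelian.Ext.zero_comp]

lemma subsingleton_ext_X₃ (W : C) {S : ShortComplex C} (hS : S.ShortExact) (n : ℕ)
    (h₁ : Subsingleton (Abelian.Ext.{w} W S.X₁ (n + 1)))
    (h₂ : Subsingleton (Abelian.Ext.{w} W S.X₂ n)) :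
    Subsingleton (Abelian.Ext.{w} W S.X₃ n) :=
  subsingleton_of_forall_eq 0 fun x => by
    obtain ⟨y, rfl⟩ := Abelian.Ext.covariant_sequence_exact₃ W hS x rfl (Subsingleton.elim _ _)
    rw [Subsingleton.elim y 0, Abelian.Ext.zero_comp]

/-- The acyclicity lemma in an abelian category, with respect to an arbitrary test object `W`. -/
theorem isZero_homology (W : C) (M : ChainComplex C ℕ) (s : ℕ)
    (hconc : ∀ i, s < i → IsZero (M.X i))
    (hhom : ∀ i, ¬ IsZero (M.homology i) → ∃ f : W ⟶ M.homology i, f ≠ 0)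
    (hext : ∀ i j, j < i → Subsingleton (Abelian.Ext.{w} W (M.X i) j)) (i : ℕ) (hi : 0 < i) :
    IsZero (M.homology i) := by
  have boundaries (i : ℕ)
      (h : ∀ j ≤ i + 1, Subsingleton (Abelian.Ext.{w} W (M.cycles (i + 1)) j)) (j : ℕ)
      (hj : j ≤ i) : Subsingleton (Abelian.Ext.{w} W (kernel (M.homologyπ i)) j) := by
    obtain ⟨_, _, hS⟩ := exists_shortExact_cycles_X_boundaries M i
    exact subsingleton_ext_X₃ W hS j (h _ (by lia)) (hext _ _ (by lia))
  have homology (i : ℕ) (hi : 0 < i)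
      (h : ∀ j ≤ i + 1, Subsingleton (Abelian.Ext.{w} W (M.cycles (i + 1)) j)) :
      IsZero (M.homology i) := by
    by_contra hH
    obtain ⟨f, hf⟩ := hhom i hH
    have hX : Subsingleton (Abelian.Ext.{w} W (M.X i) 0) := hext i 0 hi
    have hZ : Subsingleton (Abelian.Ext.{w} W (M.cycles i) 0) :=
      (Abelian.Ext.postcomp_mk₀_injective_of_mono W (M.iCycles i)).subsingleton
    have hH₀ : Subsingleton (Abelian.Ext.{w} W (M.homology i) 0) :=
      subsingleton_ext_X₃ W (shortExact_boundaries_cycles_homology M i) 0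
        (boundaries i h 1 hi) hZ
    exact hf (Abelian.Ext.homEquiv₀.symm.injective (Subsingleton.elim _ _))
  have cycles (n i : ℕ) (hi : 0 < i) (hn : s < i + n) :
      ∀ j ≤ i, Subsingleton (Abelian.Ext.{w} W (M.cycles i) j) := by
    induction n generalizing i with
    | zero =>
      exact fun j _ => subsingleton_ext_of_isZero W ((hconc i hn).of_mono (M.iCycles i)) j
    | succ n ih =>
      have h := ih (i + 1) (by lia) (by lia)
      exact fun j hj => subsingleton_ext_X₂ W (shortExact_boundaries_cycles_homology M i) j
        (boundaries i h j hj) (subsingleton_ext_of_isZero W (homology i hi h) j)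
  exact homology i hi (cycles s (i + 1) (by lia) (by lia))

/-- Vanishing of `Ext`, defined by deriving in the first variable, implies vanishing of `Ext`
defined through the derived category. -/
lemma subsingleton_ext_of_isZero_derived (R : Type*) [Ring R] [Linear R C] [EnoughProjectives C]
    (X Y : C) (n : ℕ) (h : IsZero (((Ext R C n).obj (Opposite.op X)).obj Y)) :
    Subsingleton (Abelian.Ext.{w} X Y n) := by
  let P := projectiveResolution X
  have hP : (P.complex.linearYonedaObj R Y).ExactAt n :=
    (HomologicalComplex.exactAt_iff_isZero_homology _ _).2 (h.of_iso (P.isoExt n Y).symm)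
  refine subsingleton_of_forall_eq 0 fun x => ?_
  obtain ⟨f, hf, rfl⟩ := P.extMk_surjective x (n + 1) rfl
  cases n with
  | zero =>
    rw [HomologicalComplex.exactAt_iff' _ 0 0 1 (by simp) (by simp),
      ShortComplex.moduleCat_exact_iff] at hP
    obtain ⟨g, hg⟩ := hP f hf
    have hf₀ : f = 0 := by
      rw [← hg]
      change P.complex.d 0 0 ≫ g = 0
      exact (congrArg (· ≫ g) (P.complex.shape 0 0 (by simp))).trans zero_comp
    subst hf₀
    exact P.extMk_zero _ _
  | succ n =>
    rw [HomologicalComplex.exactAt_iff' _ n (n + 1) (n + 2) (by simp) (by simp),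
      ShortComplex.moduleCat_exact_iff] at hP
    obtain ⟨g, hg⟩ := hP f hf
    exact (P.extMk_eq_zero_iff f _ rfl hf n rfl).2 ⟨g, hg⟩

end Abelian

end AcyclicityLemma

/-- Acyclicity lemma of Peskine and Szpiro, first conclusion: if every nonzero
homology module of the complex `0 → M_s → ⋯ → M_0 → 0` has depth `0`, and
`depth M_i ≥ i` (i.e. `Ext^j(k, M_i) = 0` for `j < i`), then `H_i(M) = 0` for `i > 0`. -/
theorem acyclicity_lemma_first
    (A : Type) [CommRing A] [IsLocalRing A] [IsNoetherianRing A]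
    (s : ℕ) (M : ChainComplex (ModuleCat A) ℕ)
    (hconc : ∀ i, s < i → IsZero (M.X i))
    (hdepth_zero : ∀ i, ¬ IsZero (M.homology i) →
      ∃ f : ModuleCat.of A (IsLocalRing.ResidueField A) ⟶ M.homology i, f ≠ 0)
    (hdepth : ∀ i, i ≤ s → ∀ j, j < i →
      IsZero (((Ext A (ModuleCat A) j).obj
        (Opposite.op (ModuleCat.of A (IsLocalRing.ResidueField A)))).obj (M.X i))) :
    ∀ i, 0 < i → IsZero (M.homology i) := by
  refine AcyclicityLemma.isZero_homology.{0} (ModuleCat.of A (IsLocalRing.ResidueField A)) M s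
    hconc hdepth_zero fun i j hij => ?_
  obtain hi | hi := le_or_gt i s
  · exact AcyclicityLemma.subsingleton_ext_of_isZero_derived A _ _ j (hdepth i hi j hij)
  · exact AcyclicityLemma.subsingleton_ext_of_isZero _ (hconc i hi) j
end

section
/- Let (A, 𝔪) be a commutative Noetherian local ring with residue field k = A/𝔪, and let 0 → M_s → M_{s-1} → ⋯ → M_0 → 0 be a chain complex of (not necessarily finitely generated) A-modules concentrated in homological degrees 0,…,s such that every nonzero homology module H_i(M_•) has depth 0, i.e. Hom_A(k, H_i(M_•)) ≠ 0 whenever H_i(M_•) ≠ 0. If for every i with 0 ≤ i ≤ s one has Ext^j_A(k, M_i) = 0 for all j ≤ i (that is, depth_A(M_i) > i), then the complex M_• is exact: H_i(M_•) = 0 for all i. -/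
open CategoryTheory CategoryTheory.Limits

namespace CategoryTheory

universe w v u

variable {C : Type u} [Category.{v} C] [Abelian C]

/-- The vanishing of `Ext`, computed from projective resolutions, implies the vanishing of
`Abelian.Ext`, computed in the derived category. -/
lemma subsingleton_abelianExt_of_isZero_ext {R : Type*} [Ring R] [Linear R C]
    [EnoughProjectives C] [HasExt.{w} C] {X Y : C} {n : ℕ}
    (h : IsZero (((Ext R C n).obj (Opposite.op X)).obj Y)) :
    Subsingleton (Abelian.Ext X Y n) := by
  let P : ProjectiveResolution X := projectiveResolution X
  have hP := (P.isoExt (R := R) n Y).isZero_iff.1 h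
  rw [← HomologicalComplex.exactAt_iff_isZero_homology] at hP
  refine subsingleton_of_forall_eq 0 fun α ↦ ?_
  obtain ⟨f, hf, rfl⟩ := P.extMk_surjective α (n + 1) rfl
  cases n with
  | zero =>
    rw [HomologicalComplex.exactAt_iff' _ 0 0 1 (by simp) (by simp),
      ShortComplex.moduleCat_exact_iff] at hP
    obtain ⟨g, rfl⟩ : ∃ g : P.complex.X 0 ⟶ Y, P.complex.d 0 0 ≫ g = f := hP f hf
    simp
  | succ n =>
    rw [HomologicalComplex.exactAt_iff' _ n (n + 1) (n + 2) (by simp) (by simp),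
      ShortComplex.moduleCat_exact_iff] at hP
    exact (P.extMk_eq_zero_iff f _ rfl hf n rfl).2 (hP f hf)

/-- In the long exact sequence attached to a short exact sequence, `Ext X S.X₃ n` vanishes
if `Ext X S.X₂ n` and `Ext X S.X₁ (n + 1)` do. -/
lemma ShortComplex.ShortExact.subsingleton_ext_X₃ [HasExt.{w} C] {S : ShortComplex C}
    (hS : S.ShortExact) (X : C) (n : ℕ) [Subsingleton (Abelian.Ext X S.X₂ n)]
    [Subsingleton (Abelian.Ext X S.X₁ (n + 1))] : Subsingleton (Abelian.Ext X S.X₃ n) := by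
  refine subsingleton_of_forall_eq 0 fun x₃ ↦ ?_
  obtain ⟨x₂, rfl⟩ :=
    Abelian.Ext.covariant_sequence_exact₃ X hS x₃ rfl (Subsingleton.elim _ _)
  rw [Subsingleton.elim x₂ 0, Abelian.Ext.zero_comp]

end CategoryTheory

namespace ChainComplex

universe w v u

variable {C : Type u} [Category.{v} C] [Abelian C]

/-- If `M` is exact in degree `r + 1`, then `0 ⟶ M.opcycles (r + 1) ⟶ M.X r ⟶ M.opcycles r ⟶ 0`
is a short exact sequence. -/
lemma shortExact_fromOpcycles_pOpcycles (M : ChainComplex C ℕ) (r : ℕ)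
    (h : M.ExactAt (r + 1)) :
    (ShortComplex.mk (M.fromOpcycles (r + 1) r) (M.pOpcycles r)
      (by simp [← cancel_epi (M.pOpcycles (r + 1))])).ShortExact where
  exact := by
    refine ShortComplex.exact_of_g_is_cokernel _
      (CokernelCofork.IsColimit.ofπ _ _
        (fun k hk ↦ M.descOpcycles k (r + 1) (by simp)
          (by rw [← M.p_fromOpcycles, Category.assoc, hk, comp_zero]))
        (fun k hk ↦ by simp)
        (fun k hk m hm ↦ by simp [← cancel_epi (M.pOpcycles r), hm]))
  mono_f := by
    dsimp
    rw [Preadditive.mono_iff_cancel_zero]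
    have h' := (M.homologyIsKernel (r + 1) r (by simp))
    intro T g hg
    rw [← KernelFork.IsLimit.lift' h' g hg |>.2, h.isZero_homology.eq_of_tgt
      (KernelFork.IsLimit.lift' h' g hg).1 0, zero_comp]
  epi_g := by dsimp; infer_instance

/-- If `M` vanishes above degree `s` and is exact above degree `i`, then the vanishing of
`Ext X (M.X r) j` for all `j ≤ r` implies that of `Ext X (M.opcycles r) j` for `i ≤ r`
and `j ≤ r`. -/
lemma subsingleton_ext_opcycles [HasExt.{w} C] (M : ChainComplex C ℕ) (X : C) (s i : ℕ)
    (hconc : ∀ r, s < r → IsZero (M.X r)) (hexact : ∀ r, i < r → M.ExactAt r)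
    (hM : ∀ r ≤ s, ∀ j ≤ r, Subsingleton (Abelian.Ext X (M.X r) j))
    (r : ℕ) (hr : i ≤ r) (j : ℕ) (hj : j ≤ r) :
    Subsingleton (Abelian.Ext X (M.opcycles r) j) := by
  by_cases hrs : s < r
  · refine subsingleton_of_forall_eq 0 fun x ↦ ?_
    rw [← x.comp_mk₀_id, ((hconc r hrs).of_epi (M.pOpcycles r)).eq_of_src (𝟙 _) 0,
      Abelian.Ext.mk₀_zero, Abelian.Ext.comp_zero]
  · have := hM r (by lia) j hj
    have := M.subsingleton_ext_opcycles X s i hconc hexact hM (r + 1) (by lia) (j + 1) (by lia)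
    exact (M.shortExact_fromOpcycles_pOpcycles r (hexact _ (by lia))).subsingleton_ext_X₃ X j
termination_by s + 1 - r

end ChainComplex

/-- Acyclicity lemma of Peskine and Szpiro, second conclusion: if every nonzero
homology module of the complex `0 → M_s → ⋯ → M_0 → 0` has depth `0`, and
`depth M_i > i` (i.e. `Ext^j(k, M_i) = 0` for `j ≤ i`), then the complex is exact. -/
theorem acyclicity_lemma_second
    (A : Type) [CommRing A] [IsLocalRing A] [IsNoetherianRing A]
    (s : ℕ) (M : ChainComplex (ModuleCat A) ℕ)
    (hconc : ∀ i, s < i → IsZero (M.X i))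
    (hdepth_zero : ∀ i, ¬ IsZero (M.homology i) →
      ∃ f : ModuleCat.of A (IsLocalRing.ResidueField A) ⟶ M.homology i, f ≠ 0)
    (hdepth : ∀ i, i ≤ s → ∀ j, j ≤ i →
      IsZero (((Ext A (ModuleCat A) j).obj
        (Opposite.op (ModuleCat.of A (IsLocalRing.ResidueField A)))).obj (M.X i))) :
    ∀ i, IsZero (M.homology i) := by
  intro i
  by_cases his : s < i
  · exact (HomologicalComplex.ExactAt.of_isZero (hconc i his)).isZero_homology
  induction hn : s - i using Nat.strong_induction_on generalizing i with
  | _ n ih =>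
  have hexact : ∀ r, i < r → M.ExactAt r := fun r hr ↦ by
    by_cases hrs : s < r
    · exact .of_isZero (hconc r hrs)
    · rw [HomologicalComplex.exactAt_iff_isZero_homology]
      exact ih (s - r) (by lia) r hrs rfl
  by_contra hi
  obtain ⟨f, hf⟩ := hdepth_zero i hi
  have := M.subsingleton_ext_opcycles (ModuleCat.of A (IsLocalRing.ResidueField A)) s i hconc
    hexact (fun r hr j hj ↦ subsingleton_abelianExt_of_isZero_ext (hdepth r hr j hj))
    i le_rfl 0 (Nat.zero_le i)
  refine hf ?_
  rw [← cancel_mono (M.homologyι i), zero_comp, ← Abelian.Ext.mk₀_eq_zero_iff]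
  exact Subsingleton.elim _ _
end

section
/- (Intersection theorem.) Let (A, 𝔪) be a commutative Noetherian local ring which is an algebra over ℂ, of Krull dimension d. Let 0 → M_s → M_{s-1} → ⋯ → M_0 → 0 be a chain complex of finitely generated free A-modules, concentrated in homological degrees 0,…,s, which is not exact, and such that every homology module H_i(M_•) has finite length (equivalently, is annihilated by a power of 𝔪). Then s ≥ d. -/
open CategoryTheory CategoryTheory.Limits

open scoped Matrix in
/-- A bounded complex of finite free modules, in matrix form, with null-homotopies for the
multiplications by the `x j`, and a cycle `v` which a linear form `lam`
distinguishes from the boundaries modulo the radical of `(x)`.  The module in degree `0` is zero. -/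
structure KoszulDatum (A : Type) [CommRing A] (d s : ℕ) (x : Fin d → A) where
  n : ℕ → ℕ
  n_zero : n 0 = 0
  n_large : ∀ i, s + 1 < i → n i = 0
  D : ∀ i, Matrix (Fin (n i)) (Fin (n (i + 1))) A
  H : Fin d → ∀ i, Matrix (Fin (n (i + 1))) (Fin (n i)) A
  D_mul : ∀ i, D i * D (i + 1) = 0
  homotopy : ∀ j i, D (i + 1) * H j (i + 1) + H j i * D i = x j • (1 : Matrix _ _ A)
  i0 : ℕ
  v : Fin (n (i0 + 1)) → A
  lam : Fin (n (i0 + 1)) → A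
  N : ℕ
  b : Fin (n (i0 + 1 + 1)) → Fin d → A
  cycle : D i0 *ᵥ v = 0
  lam_v : lam ⬝ᵥ v = 1
  boundary : ∀ l, (lam ᵥ* D (i0 + 1)) l ^ N = ∑ j, b l j * x j

namespace KoszulDatum

open Matrix

variable {A B : Type} [CommRing A] [CommRing B] {d s : ℕ} {x : Fin d → A}

/-- Base change along a ring homomorphism. -/
def map (K : KoszulDatum A d s x) (f : A →+* B) : KoszulDatum B d s (fun j => f (x j)) where
  n := K.n
  n_zero := K.n_zero
  n_large := K.n_large
  D i := (K.D i).map f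
  H j i := (K.H j i).map f
  D_mul i := by
    rw [← Matrix.map_mul, K.D_mul, Matrix.map_zero _ (map_zero f)]
  homotopy j i := by
    have h := congrArg (fun M => M.map f) (K.homotopy j i)
    simp only [Matrix.map_add f (map_add f), Matrix.map_mul] at h
    rw [h]
    ext a c
    by_cases hac : a = c <;> simp [hac]
  i0 := K.i0
  v := f ∘ K.v
  lam := f ∘ K.lam
  N := K.N
  b l j := f (K.b l j)
  cycle := by
    ext a
    have h := congrFun K.cycle a
    rw [← RingHom.map_mulVec, h]
    simp
  lam_v := by
    rw [← RingHom.map_dotProduct, K.lam_v, map_one]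
  boundary l := by
    rw [← RingHom.map_vecMul, ← map_pow, K.boundary, map_sum]
    simp

/-- If the `y j` form a sequence which is regular up to multiplication by `c`, the complex is
exact in high degrees up to a power of `c`. -/
theorem exists_boundary (K : KoszulDatum A d s x) (c : A)
    (hc : ∀ (k : Fin d) (a : A), x k * a ∈ Ideal.span (x '' {j | j < k}) →
      c * a ∈ Ideal.span (x '' {j | j < k})) (m : ℕ) (hm : m ≤ d) (i : ℕ)
    (hi : s + 1 < i + 1 + m) (z : Fin (K.n (i + 1)) → A)
    (hz : ∀ a, (K.D i *ᵥ z) a ∈ Ideal.span (x '' {j | (j : ℕ) < d - m})) :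
    ∃ w, ∀ a, (c ^ m • z - K.D (i + 1) *ᵥ w) a ∈ Ideal.span (x '' {j | (j : ℕ) < d - m}) := by
  induction m generalizing i with
  | zero =>
    have h0 := K.n_large (i + 1) (by omega)
    refine ⟨0, fun a => ?_⟩
    rw [h0] at a
    exact a.elim0
  | succ m ih =>
    let k : Fin d := ⟨d - (m + 1), by omega⟩
    set I := Ideal.span (x '' {j | (j : ℕ) < d - (m + 1)}) with hI
    have hIk : Ideal.span (x '' {j | j < k}) = I := by
      rw [hI]; rfl
    have hset : {j : Fin d | (j : ℕ) < d - m} = insert k {j : Fin d | (j : ℕ) < d - (m + 1)} := by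
      ext j
      simp only [Set.mem_ofPred_eq, Set.mem_insert_iff, Fin.ext_iff, k]
      omega
    have hmulI : ∀ {p q : ℕ} (M : Matrix (Fin p) (Fin q) A) (u : Fin q → A),
        (∀ a, u a ∈ I) → ∀ a, (M *ᵥ u) a ∈ I := fun M u hu a => by
      rw [mulVec, dotProduct]
      exact Ideal.sum_mem _ fun b _ => I.mul_mem_left _ (hu b)
    have hDu : K.D (i + 1) *ᵥ (K.H k (i + 1) *ᵥ z) = x k • z - K.H k i *ᵥ (K.D i *ᵥ z) := by
      rw [mulVec_mulVec, mulVec_mulVec, eq_sub_iff_add_eq, ← add_mulVec, K.homotopy,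
        smul_mulVec, one_mulVec]
    obtain ⟨w, hw⟩ := ih (by omega) (i + 1) (by omega) (K.H k (i + 1) *ᵥ z) (by
      intro a
      rw [hDu, hset, Set.image_insert_eq]
      refine Ideal.sub_mem _ ?_ (Ideal.span_mono (Set.subset_insert _ _) (hmulI _ _ hz a))
      rw [Pi.smul_apply, smul_eq_mul]
      exact Ideal.mul_mem_right _ _ (Ideal.subset_span (Set.mem_insert _ _)))
    rw [hset, Set.image_insert_eq] at hw
    have hw' : ∀ a, ∃ t r, r ∈ I ∧
        (c ^ m • K.H k (i + 1) *ᵥ z - K.D (i + 1 + 1) *ᵥ w) a = t * x k + r := by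
      intro a
      obtain ⟨t, r, hr, h⟩ := Ideal.mem_span_insert.1 (hw a)
      exact ⟨t, r, hr, h⟩
    choose t r hr htr using hw'
    have hDD : K.D (i + 1) *ᵥ (K.D (i + 1 + 1) *ᵥ w) = 0 := by
      rw [mulVec_mulVec, K.D_mul, zero_mulVec]
    refine ⟨c • t, fun a => ?_⟩
    have key : x k * (c ^ m • z - K.D (i + 1) *ᵥ t) a ∈ I := by
      have h1 : c ^ m • K.H k (i + 1) *ᵥ z - K.D (i + 1 + 1) *ᵥ w = x k • t + r := by
        ext a
        rw [htr a, Pi.add_apply, Pi.smul_apply, smul_eq_mul, mul_comm]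
      have h2 := congrArg (fun u => (K.D (i + 1) *ᵥ u) a) h1
      simp only [mulVec_sub, mulVec_smul, mulVec_add, hDD, hDu, Pi.sub_apply, Pi.add_apply,
        Pi.smul_apply, smul_eq_mul, Pi.zero_apply] at h2
      have h3 : x k * (c ^ m • z - K.D (i + 1) *ᵥ t) a =
          c ^ m * (K.H k i *ᵥ (K.D i *ᵥ z)) a + (K.D (i + 1) *ᵥ r) a := by
        simp only [Pi.sub_apply, Pi.smul_apply, smul_eq_mul]
        linear_combination h2
      rw [h3]
      exact I.add_mem (I.mul_mem_left _ (hmulI _ _ hz a)) (hmulI _ _ hr a)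
    have := hc k _ (hIk ▸ key)
    rw [hIk] at this
    convert this using 1
    simp only [Pi.sub_apply, Pi.smul_apply, smul_eq_mul, mulVec_smul]
    ring

/-- If the `x j` form a sequence which is regular up to multiplication by `c`, a power of `c` lies
in the ideal generated by the values of `lam` on boundaries. -/
theorem pow_mem_span_vecMul (K : KoszulDatum A d s x) (hs : s < d) (c : A)
    (hc : ∀ (k : Fin d) (a : A), x k * a ∈ Ideal.span (x '' {j | j < k}) →
      c * a ∈ Ideal.span (x '' {j | j < k})) :
    c ^ d ∈ Ideal.span (Set.range (K.lam ᵥ* K.D (K.i0 + 1))) := by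
  obtain ⟨w, hw⟩ := K.exists_boundary c hc d le_rfl K.i0 (by omega) K.v
    (by simp [K.cycle])
  have h : c ^ d • K.v = K.D (K.i0 + 1) *ᵥ w := by
    ext a
    have := hw a
    simpa [sub_eq_zero] using this
  have h2 : c ^ d = (K.lam ᵥ* K.D (K.i0 + 1)) ⬝ᵥ w := by
    rw [← dotProduct_mulVec, ← h, dotProduct_smul, K.lam_v, smul_eq_mul, mul_one]
  rw [h2, dotProduct]
  exact Ideal.sum_mem _ fun l _ => Ideal.mul_mem_right _ _ (Ideal.subset_span ⟨l, rfl⟩)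

end KoszulDatum

/-- A sequence in a ring of characteristic `p` all of whose Frobenius powers are regular sequences,
generating an ideal whose powers intersect in zero. -/
structure FrobeniusRegular (p : ℕ) {R : Type} [CommRing R] {d : ℕ} (x : Fin d → R) : Prop where
  regular : ∀ (e : ℕ) (k : Fin d) (a : R),
    x k ^ p ^ e * a ∈ Ideal.span ((fun j => x j ^ p ^ e) '' {j | j < k}) →
      a ∈ Ideal.span ((fun j => x j ^ p ^ e) '' {j | j < k})
  separated : ∀ a : R, (∀ n, a ∈ Ideal.span (Set.range x) ^ n) → a = 0

theorem LinearMap.apply_mem_of_mem_ideal_map {R A : Type*} [CommRing R] [CommRing A] [Algebra R A]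
    (f : A →ₗ[R] R) (I : Ideal R) {a : A} (ha : a ∈ I.map (algebraMap R A)) : f a ∈ I := by
  have h : a ∈ I • (⊤ : Submodule R A) := by
    rw [Ideal.smul_top_eq_map]
    exact ha
  refine Submodule.smul_induction_on h (fun r hr m _ => ?_) fun a b ha hb => ?_
  · rw [map_smul]
    exact I.mul_mem_right _ hr
  · rw [map_add]
    exact I.add_mem ha hb

open scoped Matrix in
/-- The vanishing of the homology in characteristic `p`. -/
theorem KoszulDatum.le_of_frobeniusRegular {p : ℕ} (hp : p.Prime) {R A : Type} [CommRing R]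
    [IsDomain R] [CommRing A] [Algebra R A] (hpR : (p : R) = 0) {d s : ℕ} {x : Fin d → R}
    (hx : FrobeniusRegular p x) (K : KoszulDatum A d s (fun j => algebraMap R A (x j)))
    {c : R} (hc : c ≠ 0) {n : ℕ} [NeZero n] (α : A →ₗ[R] (Fin n → R)) (ι : (Fin n → R) →ₗ[R] A)
    (hαι : ∀ v, α (ι v) = c • v) (hια : ∀ a, ι (α a) = c • a) : d ≤ s := by
  by_contra! hs
  have : Fact p.Prime := ⟨hp⟩
  have hpA : (p : A) = 0 := by
    rw [← map_natCast (algebraMap R A), hpR, map_zero]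
  have hinj : Function.Injective ι := fun u v h => by
    have h2 := congrArg α h
    rw [hαι, hαι] at h2
    exact smul_right_injective _ hc h2
  have : Nontrivial A := hinj.nontrivial
  have : CharP A p := (CharP.charP_iff_prime_eq_zero hp).2 hpA
  suffices h : ∀ e, algebraMap R A c ^ d ∈
      Ideal.span (Set.range fun l => (K.lam ᵥ* K.D (K.i0 + 1)) l ^ p ^ e) by
    have hzero : c ^ (d + 1) = 0 := by
      refine hx.separated _ fun k => ?_
      have hk : k * K.N ≤ p ^ (k * K.N) := (Nat.lt_pow_self hp.one_lt).le
      have hmem : algebraMap R A c ^ d ∈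
          (Ideal.span (Set.range x) ^ k).map (algebraMap R A) := by
        refine Ideal.span_le.2 ?_ (h (k * K.N))
        rintro _ ⟨l, rfl⟩
        refine Ideal.mem_of_dvd _ (pow_dvd_pow _ hk) ?_
        rw [mul_comm k, pow_mul, Ideal.map_pow]
        refine Ideal.pow_mem_pow ?_ _
        rw [K.boundary]
        exact Ideal.sum_mem _ fun j _ => Ideal.mul_mem_left _ _
          (Ideal.mem_map_of_mem _ (Ideal.subset_span ⟨j, rfl⟩))
      have h2 := LinearMap.apply_mem_of_mem_ideal_map (LinearMap.proj 0 ∘ₗ α) _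
        (Ideal.mul_mem_right (ι (Pi.single 0 1)) _ hmem)
      rw [← map_pow, ← Algebra.smul_def, map_smul, LinearMap.comp_apply, hαι] at h2
      simpa [pow_succ] using h2
    exact hc (pow_eq_zero_iff (by omega) |>.1 hzero)
  intro e
  have h := (K.map (iterateFrobenius A p e)).pow_mem_span_vecMul hs (algebraMap R A c) ?_
  · have hr : (fun l => (K.lam ᵥ* K.D (K.i0 + 1)) l ^ p ^ e) =
        ((K.map (iterateFrobenius A p e)).lam ᵥ*
          (K.map (iterateFrobenius A p e)).D (K.i0 + 1)) := by
      ext l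
      exact RingHom.map_vecMul (iterateFrobenius A p e) _ _ l
    rw [hr]
    exact h
  · intro k a ha
    have hI : Ideal.span ((fun j => iterateFrobenius A p e (algebraMap R A (x j))) '' {j | j < k})
        = (Ideal.span ((fun j => x j ^ p ^ e) '' {j | j < k})).map (algebraMap R A) := by
      rw [Ideal.map_span, Set.image_image]
      simp [iterateFrobenius_def]
    rw [hI] at ha ⊢
    rw [iterateFrobenius_def, ← map_pow, ← Algebra.smul_def] at ha
    rw [← Algebra.smul_def, ← hια, ← Finset.univ_sum_single (α a),
      map_sum]
    refine Ideal.sum_mem _ fun l _ => ?_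
    have h1 := LinearMap.apply_mem_of_mem_ideal_map (LinearMap.proj l ∘ₗ α) _ ha
    rw [map_smul, smul_eq_mul] at h1
    have h2 := hx.regular e k _ h1
    have h3 : ι (Pi.single l (α a l)) = algebraMap R A (α a l) * ι (Pi.single l 1) := by
      rw [← Algebra.smul_def, ← map_smul, ← Pi.single_smul, smul_eq_mul, mul_one]
    rw [h3]
    exact Ideal.mul_mem_right _ _ (Ideal.mem_map_of_mem _ h2)

open scoped Matrix in
/-- A datum over a ring descends to every subring containing a suitable finite set. -/
theorem KoszulDatum.exists_descent {S : Type} [CommRing S] {d s : ℕ} {x : Fin d → S}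
    (K : KoszulDatum S d s x) : ∃ F : Set S, F.Finite ∧ ∀ A : Subring S, F ⊆ A →
      ∀ y : Fin d → A, (∀ j, (y j : S) = x j) → Nonempty (KoszulDatum A d s y) := by
  refine ⟨(⋃ i ∈ Finset.range (s + 2), Set.range fun ab : Fin (K.n i) × Fin (K.n (i + 1)) =>
      K.D i ab.1 ab.2) ∪ (⋃ i ∈ Finset.range (s + 2),
      Set.range fun ab : Fin d × Fin (K.n (i + 1)) × Fin (K.n i) => K.H ab.1 i ab.2.1 ab.2.2) ∪
      Set.range K.v ∪ Set.range K.lam ∪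
      Set.range fun lj : Fin (K.n (K.i0 + 1 + 1)) × Fin d => K.b lj.1 lj.2, ?_, ?_⟩
  · refine ((((Set.Finite.biUnion (Finset.finite_toSet _) fun _ _ => Set.finite_range _).union
      (Set.Finite.biUnion (Finset.finite_toSet _) fun _ _ => Set.finite_range _)).union
      (Set.finite_range _)).union (Set.finite_range _)).union (Set.finite_range _)
  · intro A hA y hy
    simp only [Set.union_subset_iff] at hA
    obtain ⟨⟨⟨⟨hD, hH⟩, hv⟩, hlam⟩, hb⟩ := hA
    have hlt : ∀ i, Fin (K.n i) → i < s + 2 := fun i a => by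
      by_contra! h
      rw [K.n_large i (by omega)] at a
      exact a.elim0
    have hD' : ∀ i a b, K.D i a b ∈ A := fun i a b =>
      hD (Set.mem_biUnion (Finset.mem_range.2 (hlt i a)) ⟨(a, b), rfl⟩)
    have hH' : ∀ j i a b, K.H j i a b ∈ A := fun j i a b =>
      hH (Set.mem_biUnion (Finset.mem_range.2 (hlt i b)) ⟨(j, a, b), rfl⟩)
    have hinj : Function.Injective A.subtype := Subtype.val_injective
    let D (i) : Matrix (Fin (K.n i)) (Fin (K.n (i + 1))) A := Matrix.of fun a b => ⟨_, hD' i a b⟩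
    let H (j i) : Matrix (Fin (K.n (i + 1))) (Fin (K.n i)) A :=
      Matrix.of fun a b => ⟨_, hH' j i a b⟩
    let v : Fin (K.n (K.i0 + 1)) → A := fun a => ⟨_, hv ⟨a, rfl⟩⟩
    let lam : Fin (K.n (K.i0 + 1)) → A := fun a => ⟨_, hlam ⟨a, rfl⟩⟩
    have hDm : ∀ i, (D i).map A.subtype = K.D i := fun i => rfl
    have hHm : ∀ j i, (H j i).map A.subtype = K.H j i := fun j i => rfl
    have hvm : A.subtype ∘ v = K.v := rfl
    have hlm : A.subtype ∘ lam = K.lam := rfl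
    refine ⟨{ n := K.n, n_zero := K.n_zero, n_large := K.n_large, D := D, H := H, D_mul := ?_,
              homotopy := ?_, i0 := K.i0, v := v, lam := lam, N := K.N,
              b := fun l j => ⟨_, hb ⟨(l, j), rfl⟩⟩, cycle := ?_, lam_v := ?_, boundary := ?_ }⟩
    · intro i
      apply Matrix.map_injective hinj
      simp only [Matrix.map_mul, hDm, K.D_mul]
      ext; simp
    · intro j i
      apply Matrix.map_injective hinj
      dsimp only
      rw [Matrix.map_add A.subtype (map_add A.subtype)]
      simp only [Matrix.map_mul, hDm, hHm, K.homotopy]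
      ext a b
      by_cases hab : a = b <;> simp [hab, hy]
    · ext a
      have h := RingHom.map_mulVec A.subtype (D K.i0) v a
      rw [hDm, hvm, K.cycle] at h
      exact h
    · apply hinj
      rw [RingHom.map_dotProduct, hvm, hlm, K.lam_v, map_one]
    · intro l
      apply hinj
      rw [map_pow, RingHom.map_vecMul, hlm, hDm, K.boundary, map_sum]
      simp [hy]

/-- Two evaluations `ev`, `ev'` of a ring `E` are compared on the subring generated by `T`,
whose elements become values of `ev` after multiplication by `ev G`. -/
theorem exists_ringHom_closure_of_ker_le {E Q P : Type*} [CommRing E] [CommRing Q] [CommRing P]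
    [IsDomain P] (ev : E →+* Q) (ev' : E →+* P) (hker : ∀ h, ev h = 0 → ev' h = 0) (G : E)
    (hG : ev' G ≠ 0) (T : Set Q)
    (hT : ∀ t ∈ T, ∃ h τ, ev h = ev G * t ∧ ev' h = ev' G * τ) :
    ∃ φ : Subring.closure T →+* P, ∀ (a : Subring.closure T) (h : E), ev h = a → φ a = ev' h := by
  let Γ : Subring (Q × P) :=
    { carrier := {z | ∃ (N : ℕ) (h : E), ev h = ev G ^ N * z.1 ∧ ev' h = ev' G ^ N * z.2}
      zero_mem' := ⟨0, 0, by simp, by simp⟩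
      one_mem' := ⟨0, 1, by simp, by simp⟩
      add_mem' := by
        rintro a b ⟨N, h, h1, h2⟩ ⟨M, g, h3, h4⟩
        refine ⟨N + M, h * G ^ M + g * G ^ N, ?_, ?_⟩
        · simp only [map_add, map_mul, map_pow, h1, h3, Prod.fst_add]; ring
        · simp only [map_add, map_mul, map_pow, h2, h4, Prod.snd_add]; ring
      mul_mem' := by
        rintro a b ⟨N, h, h1, h2⟩ ⟨M, g, h3, h4⟩
        refine ⟨N + M, h * g, ?_, ?_⟩
        · simp only [map_mul, h1, h3, Prod.fst_mul]; ring
        · simp only [map_mul, h2, h4, Prod.snd_mul]; ring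
      neg_mem' := by
        rintro a ⟨N, h, h1, h2⟩
        exact ⟨N, -h, by simp [h1], by simp [h2]⟩ }
  have huniq : ∀ {q : Q} {a b : P}, (q, a) ∈ Γ → (q, b) ∈ Γ → a = b := by
    rintro q a b ⟨N, h, h1, h2⟩ ⟨M, g, h3, h4⟩
    have h5 := hker (h * G ^ M - g * G ^ N) (by
      simp only [map_sub, map_mul, map_pow, h1, h3]; ring)
    simp only [map_sub, map_mul, map_pow, h2, h4] at h5
    have h6 : ev' G ^ (N + M) * (a - b) = 0 := by rw [← h5]; ring
    rcases mul_eq_zero.1 h6 with h7 | h7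
    · exact absurd h7 (pow_ne_zero _ hG)
    · exact sub_eq_zero.1 h7
  have hle : Subring.closure T ≤ Γ.map (RingHom.fst Q P) := by
    rw [Subring.closure_le]
    intro t ht
    obtain ⟨h, τ, h1, h2⟩ := hT t ht
    exact ⟨(t, τ), ⟨1, h, by simpa using h1, by simpa using h2⟩, rfl⟩
  have hex : ∀ a : Subring.closure T, ∃ τ : P, ((a : Q), τ) ∈ Γ := by
    intro a
    obtain ⟨⟨q, τ⟩, h, h'⟩ := hle a.2
    simp only [RingHom.coe_fst] at h'
    exact ⟨τ, h' ▸ h⟩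
  choose φ hφ using hex
  refine ⟨{ toFun := φ
            map_one' := huniq (hφ 1) Γ.one_mem
            map_zero' := huniq (hφ 0) Γ.zero_mem
            map_add' := fun a b => huniq (hφ _) (Γ.add_mem (hφ a) (hφ b))
            map_mul' := fun a b => huniq (hφ _) (Γ.mul_mem (hφ a) (hφ b)) }, fun a h ha => ?_⟩
  exact huniq (hφ a) ⟨0, h, by simpa using ha, by simp⟩

/-- Finitely many elements of a domain which are algebraic over a subring of characteristic zero
are, up to a common denominator, polynomials in one integral element. -/
theorem exists_isIntegral_aeval_eq_smul {E Q : Type*} [CommRing E] [IsDomain E] [CharZero E]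
    [CommRing Q] [IsDomain Q] [Algebra E Q] (hinj : Function.Injective (algebraMap E Q))
    (T : Set Q) (hT : T.Finite) (halg : ∀ t ∈ T, IsAlgebraic E t) :
    ∃ (θ : Q) (D : E), IsIntegral E θ ∧ D ≠ 0 ∧
      ∀ t ∈ T, ∃ q : Polynomial E, Polynomial.aeval θ q = D • t := by
  let F := FractionRing E
  let L := FractionRing Q
  have : FaithfulSMul E Q := (faithfulSMul_iff_algebraMap_injective E Q).2 hinj
  have hQL : Function.Injective (algebraMap Q L) := IsFractionRing.injective Q L
  have hEL : Function.Injective (algebraMap E L) := by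
    rw [IsScalarTower.algebraMap_eq E Q L]
    exact hQL.comp hinj
  have hsm : ∀ (e : E) (q : Q), algebraMap Q L (e • q) = e • algebraMap Q L q := fun e q => by
    rw [Algebra.smul_def, map_mul, ← IsScalarTower.algebraMap_apply, ← Algebra.smul_def]
  have : FaithfulSMul E L := (faithfulSMul_iff_algebraMap_injective E L).2 hEL
  let _ : Algebra F L := FractionRing.liftAlgebra E L
  have : CharZero F := charZero_of_injective_algebraMap (IsFractionRing.injective E F)
  let U : Set L := algebraMap Q L '' T
  have : Finite U := (hT.image _).to_subtype
  have hUalg : ∀ u ∈ U, IsAlgebraic F u := by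
    rintro _ ⟨t, ht, rfl⟩
    exact ((halg t ht).algebraMap).extendScalars (IsFractionRing.injective E F)
  let M := IntermediateField.adjoin F U
  have : FiniteDimensional F M :=
    IntermediateField.finiteDimensional_adjoin fun u hu => (hUalg u hu).isIntegral
  obtain ⟨θ₀, hθ₀⟩ := Field.exists_primitive_element F M
  have hden : ∀ z ∈ Algebra.adjoin F U, ∃ e : E, e ≠ 0 ∧ ∃ q : Q, e • z = algebraMap Q L q := by
    intro z hz
    induction hz using Algebra.adjoin_induction with
    | mem u hu =>
      obtain ⟨t, -, rfl⟩ := hu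
      exact ⟨1, one_ne_zero, t, one_smul _ _⟩
    | algebraMap r =>
      obtain ⟨a, b, hb, rfl⟩ := IsFractionRing.div_surjective (A := E) r
      have hb0 : b ≠ 0 := nonZeroDivisors.ne_zero hb
      refine ⟨b, hb0, algebraMap E Q a, ?_⟩
      have : algebraMap E L b ≠ 0 := fun h => hb0 (hEL (by rw [h, map_zero]))
      rw [← IsScalarTower.algebraMap_apply, map_div₀, ← IsScalarTower.algebraMap_apply,
        ← IsScalarTower.algebraMap_apply, Algebra.smul_def]
      exact mul_div_cancel₀ _ this
    | add x y _ _ hx hy =>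
      obtain ⟨e, he, q, hq⟩ := hx
      obtain ⟨e', he', q', hq'⟩ := hy
      refine ⟨e * e', mul_ne_zero he he', e' • q + e • q', ?_⟩
      rw [map_add, hsm, hsm, ← hq, ← hq', smul_add, smul_smul,
        smul_smul, mul_comm e' e]
    | mul x y _ _ hx hy =>
      obtain ⟨e, he, q, hq⟩ := hx
      obtain ⟨e', he', q', hq'⟩ := hy
      refine ⟨e * e', mul_ne_zero he he', q * q', ?_⟩
      rw [map_mul, ← hq, ← hq', smul_mul_smul_comm]
  have hθmem : (θ₀ : L) ∈ Algebra.adjoin F U := by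
    rw [← IntermediateField.adjoin_toSubalgebra_of_isAlgebraic hUalg]
    exact θ₀.2
  obtain ⟨e, he, θ₁, hθ₁⟩ := hden _ hθmem
  have hθ₁alg : IsAlgebraic E θ₁ := by
    rw [← isAlgebraic_algebraMap_iff hQL, ← hθ₁]
    have h1 : IsAlgebraic F (θ₀ : L) := by
      have h2 : IsAlgebraic F θ₀ := Algebra.IsAlgebraic.isAlgebraic θ₀
      exact h2.algebraMap (A := L)
    exact ((IsFractionRing.isAlgebraic_iff E F L).2 h1).smul e
  obtain ⟨e', he', hθInt⟩ := hθ₁alg.exists_integral_multiple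
  have hee : algebraMap E F (e' * e) ≠ 0 := fun h =>
    mul_ne_zero he' he (IsFractionRing.injective E F (by rw [h, map_zero]))
  have hθ : algebraMap Q L (e' • θ₁) = algebraMap E F (e' * e) • (θ₀ : L) := by
    rw [hsm, ← hθ₁, smul_smul, algebraMap_smul]
  have hall : ∀ t ∈ T, ∃ (D : E) (q : Polynomial E), D ≠ 0 ∧
      Polynomial.aeval (e' • θ₁) q = D • t := by
    intro t ht
    let tM : M := ⟨algebraMap Q L t, IntermediateField.subset_adjoin F U ⟨t, ht, rfl⟩⟩
    have h1 : tM ∈ Algebra.adjoin F {θ₀} := by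
      rw [← IntermediateField.adjoin_simple_toSubalgebra_of_isAlgebraic
        (Algebra.IsAlgebraic.isAlgebraic θ₀), hθ₀]
      trivial
    rw [Algebra.adjoin_singleton_eq_range_aeval] at h1
    obtain ⟨q, hq⟩ := h1
    have hq' : Polynomial.aeval (θ₀ : L) q = algebraMap Q L t := by
      have h := congrArg (algebraMap M L) hq
      exact (Polynomial.aeval_algebraMap_apply L θ₀ q).trans h
    let q₁ : Polynomial F := q.comp (Polynomial.C (algebraMap E F (e' * e))⁻¹ * Polynomial.X)
    have hq₁ : Polynomial.aeval (algebraMap Q L (e' • θ₁)) q₁ = algebraMap Q L t := by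
      rw [Polynomial.aeval_comp, map_mul, Polynomial.aeval_C, Polynomial.aeval_X,
        ← Algebra.smul_def, hθ, smul_smul, inv_mul_cancel₀ hee, one_smul, hq']
    obtain ⟨b, hb, hbq⟩ := IsLocalization.integerNormalization_spec (nonZeroDivisors E) q₁
    refine ⟨b, IsLocalization.integerNormalization (nonZeroDivisors E) q₁,
      nonZeroDivisors.ne_zero hb, ?_⟩
    apply hQL
    rw [← Polynomial.aeval_algebraMap_apply, ← Polynomial.aeval_map_algebraMap F, hbq,
      ← algebraMap_smul F b q₁, map_smul, hq₁, algebraMap_smul, hsm]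
  choose! D q hD hq using hall
  refine ⟨e' • θ₁, ∏ t ∈ hT.toFinset, D t, hθInt,
    Finset.prod_ne_zero_iff.2 fun t ht => hD t (hT.mem_toFinset.1 ht), fun t ht => ?_⟩
  obtain ⟨r, hr⟩ := Finset.dvd_prod_of_mem D (hT.mem_toFinset.2 ht)
  refine ⟨Polynomial.C r * q t, ?_⟩
  rw [hr, map_mul, hq t ht, Polynomial.aeval_C, ← Algebra.smul_def, smul_smul, mul_comm]

/-- Evaluation of a polynomial over `ℤ[σ]` at `y` and `θ`. -/
noncomputable def evalPoly {σ B : Type*} [CommRing B] (y : σ → B) (θ : B) :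
    Polynomial (MvPolynomial σ ℤ) →+* B :=
  Polynomial.eval₂RingHom (MvPolynomial.eval₂Hom (Int.castRingHom B) y) θ

theorem map_evalPoly {σ B B' : Type*} [CommRing B] [CommRing B'] (g : B →+* B') (y : σ → B)
    (θ : B) (h : Polynomial (MvPolynomial σ ℤ)) :
    g (evalPoly y θ h) = evalPoly (fun i => g (y i)) (g θ) h := by
  suffices H : g.comp (evalPoly y θ) = evalPoly (fun i => g (y i)) (g θ) from congrArg (· h) H
  refine Polynomial.ringHom_ext' (MvPolynomial.ringHom_ext (fun r => ?_) fun i => ?_) ?_ <;>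
  simp [evalPoly]

theorem evalPoly_C_X {σ B : Type*} [CommRing B] (y : σ → B) (θ : B) (i : σ) :
    evalPoly y θ (Polynomial.C (MvPolynomial.X i)) = y i := by
  simp [evalPoly]

theorem evalPoly_sub_mem {σ B : Type*} [CommRing B] (I : Ideal B) {y y' : σ → B} {θ θ' : B}
    (hy : ∀ i, y i - y' i ∈ I) (hθ : θ - θ' ∈ I) (h : Polynomial (MvPolynomial σ ℤ)) :
    evalPoly y θ h - evalPoly y' θ' h ∈ I := by
  rw [← Ideal.Quotient.eq, map_evalPoly, map_evalPoly, Ideal.Quotient.eq.2 hθ]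
  simp_rw [Ideal.Quotient.eq.2 (hy _)]

/-- A finitely generated subring of a domain of characteristic zero, up to a denominator, is
generated by algebraically independent elements and one integral element. -/
theorem exists_presentation {Q : Type*} [CommRing Q] [IsDomain Q] [CharZero Q] {d : ℕ}
    {X : Fin d → Q} (hX : AlgebraicIndependent ℤ X) (T : Set Q) (hT : T.Finite)
    (hXT : ∀ i, X i ∈ T) {β : Q} (hβ0 : β ≠ 0) (hβ : β ∈ Subring.closure T) :
    ∃ (s : Set Q) (θ : Q) (f G : Polynomial (MvPolynomial s ℤ)), s.Finite ∧ (∀ i, X i ∈ s) ∧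
      evalPoly (fun i : s => (i : Q)) θ f = 0 ∧
      (∀ h, evalPoly (fun i : s => (i : Q)) θ h = 0 → f ∣ h) ∧ Polynomial.derivative f ∣ G ∧
      evalPoly (fun i : s => (i : Q)) θ G ≠ 0 ∧
      (∀ t ∈ T, ∃ P, evalPoly (fun i : s => (i : Q)) θ P =
        evalPoly (fun i : s => (i : Q)) θ G * t) ∧
      ∃ γ e, (∃ P, evalPoly (fun i : s => (i : Q)) θ P =
        evalPoly (fun i : s => (i : Q)) θ G * γ) ∧
        evalPoly (fun i : s => (i : Q)) θ e = β * γ ∧ e ∣ G := by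
  obtain ⟨s, hXs, ⟨hs, hsT⟩, hmax⟩ := exists_maximal_algebraicIndependent (R := ℤ) (Set.range X) T
    (Set.range_subset_iff.2 hXT) hX.coe_range
  have hsfin := hT.subset hsT
  let E := MvPolynomial s ℤ
  let _ : Algebra E Q := (MvPolynomial.aeval (R := ℤ) (fun i : s => (i : Q))).toAlgebra
  have hinj : Function.Injective (algebraMap E Q) := hs
  have : FaithfulSMul E Q := (faithfulSMul_iff_algebraMap_injective E Q).2 hinj
  have hev : ∀ θ : Q, ∀ h, evalPoly (fun i : s => (i : Q)) θ h = Polynomial.aeval θ h := by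
    intro θ h
    rfl
  have halg : ∀ t ∈ T, IsAlgebraic E t := by
    intro t ht
    have h1 : IsAlgebraic (Algebra.adjoin ℤ s) t := by
      by_contra htr
      have hi := AlgebraicIndepOn.insert (R := ℤ) (x := id) (s := s) (i := t) hs
        (by rw [Set.image_id]; exact htr)
      have hts : t ∈ s := hmax ⟨hi, Set.insert_subset ht hsT⟩ (Set.subset_insert _ _)
        (Set.mem_insert _ _)
      exact htr (isAlgebraic_algebraMap (⟨t, Algebra.subset_adjoin hts⟩ : Algebra.adjoin ℤ s))
    have hadj : Algebra.adjoin ℤ s =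
        (MvPolynomial.aeval (R := ℤ) (fun i : s => (i : Q))).range := by
      rw [← Algebra.adjoin_range_eq_range_aeval, Subtype.range_coe]
    have hmem : ∀ a : Algebra.adjoin ℤ s, ∃ e : E, algebraMap E Q e = a := fun a =>
      hadj.le a.2
    let g : E →+* Algebra.adjoin ℤ s := (algebraMap E Q).codRestrict (Algebra.adjoin ℤ s) fun e =>
      hadj.ge ⟨e, rfl⟩
    exact h1.of_ringHom_of_comp_eq g (RingHom.id Q)
      (fun a => (hmem a).imp fun e he => Subtype.ext he)
      Function.injective_id rfl
  have hβalg : IsAlgebraic E β := by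
    have hle : Subring.closure T ≤ (Subalgebra.algebraicClosure E Q).toSubring :=
      Subring.closure_le.2 fun t ht => halg t ht
    exact hle hβ
  obtain ⟨e, he0, γ, hγ⟩ := hβalg.exists_nonzero_dvd (mem_nonZeroDivisors_of_ne_zero hβ0)
  have hγalg : IsAlgebraic E γ := IsAlgebraic.of_mul (mem_nonZeroDivisors_of_ne_zero hβ0) hβalg
    (hγ ▸ isAlgebraic_algebraMap e)
  obtain ⟨θ, D, hθ, hD, hq⟩ := exists_isIntegral_aeval_eq_smul hinj (insert γ T) (hT.insert γ) (by
    rintro t (rfl | ht)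
    exacts [hγalg, halg t ht])
  have hder : Polynomial.aeval θ (Polynomial.derivative (minpoly E θ)) ≠ 0 := by
    intro h0
    have hdvd := minpoly.isIntegrallyClosed_dvd hθ h0
    have hpos := minpoly.natDegree_pos hθ
    have hne : Polynomial.derivative (minpoly E θ) ≠ 0 := fun h =>
      hpos.ne' (Polynomial.derivative_eq_zero.1 h)
    exact (Polynomial.natDegree_le_of_dvd hdvd hne).not_gt
      (Polynomial.natDegree_derivative_lt hpos.ne')
  have hP : ∀ t ∈ insert γ T, ∃ P, evalPoly (fun i : s => (i : Q)) θ P =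
      evalPoly (fun i : s => (i : Q)) θ
        (Polynomial.C e * Polynomial.C D * Polynomial.derivative (minpoly E θ)) * t := by
    intro t ht
    obtain ⟨q, hq⟩ := hq t ht
    refine ⟨Polynomial.C e * q * Polynomial.derivative (minpoly E θ), ?_⟩
    simp only [hev, map_mul, hq, Polynomial.aeval_C, Algebra.smul_def]
    ring
  refine ⟨s, θ, minpoly E θ, Polynomial.C e * Polynomial.C D *
    Polynomial.derivative (minpoly E θ), hsfin, fun i => hXs ⟨i, rfl⟩, ?_, ?_, Dvd.intro_left _ rfl,
    ?_, fun t ht => hP t (Set.mem_insert_of_mem _ ht), γ, Polynomial.C e,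
    hP γ (Set.mem_insert _ _), ?_, Dvd.intro _ (mul_assoc _ _ _).symm⟩
  · rw [hev, minpoly.aeval]
  · intro h hh
    exact minpoly.isIntegrallyClosed_dvd hθ (by rwa [← hev])
  · simp only [hev, map_mul, Polynomial.aeval_C]
    refine mul_ne_zero (mul_ne_zero ?_ ?_) hder
    · exact fun h => he0 (hinj (by rw [h, map_zero]))
    · exact fun h => hD (hinj (by rw [h, map_zero]))
  · rw [hev, Polynomial.aeval_C, hγ]

/-- Solving `s + s² k(s) + b = 0` in a complete ring. -/
theorem exists_add_sq_mul_eval_add_eq_zero {P : Type*} [CommRing P] (I : Ideal P)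
    [IsAdicComplete I P] (k : Polynomial P) {b : P} (hb : b ∈ I) :
    ∃ s, s + s ^ 2 * k.eval s + b = 0 ∧ b ∣ s := by
  have hcontr : ∀ (n : ℕ) (s t : P), s ∈ I → t ∈ I → s - t ∈ I ^ n →
      s ^ 2 * k.eval s - t ^ 2 * k.eval t ∈ I ^ (n + 1) := by
    intro n s t hs ht hst
    obtain ⟨r, hr⟩ := k.sub_dvd_eval_sub s t
    have h : s ^ 2 * k.eval s - t ^ 2 * k.eval t =
        (s - t) * ((s + t) * k.eval s + t * (t * r)) := by
      linear_combination t ^ 2 * hr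
    rw [h, pow_succ]
    exact Ideal.mul_mem_mul hst (I.add_mem (I.mul_mem_right _ (I.add_mem hs ht))
      (I.mul_mem_right _ ht))
  let u : ℕ → P := fun n => Nat.rec 0 (fun _ s => -b - s ^ 2 * k.eval s) n
  have hu : ∀ n, u (n + 1) = -b - u n ^ 2 * k.eval (u n) := fun n => rfl
  have huI : ∀ n, u n ∈ I := by
    intro n
    induction n with
    | zero => exact I.zero_mem
    | succ n ih =>
      rw [hu]
      exact I.sub_mem (I.neg_mem hb) (I.mul_mem_right _ (I.pow_mem_of_mem ih _ two_pos))
  have hstep : ∀ n, u n - u (n + 1) ∈ I ^ n := by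
    intro n
    induction n with
    | zero => simp
    | succ n ih =>
      have h := hcontr n _ _ (huI n) (huI (n + 1)) ih
      rw [hu n, hu (n + 1), ← neg_mem_iff]
      convert h using 1
      rw [hu n]
      ring
  have hcauchy : ∀ {m n : ℕ}, m ≤ n → u m ≡ u n [SMOD (I ^ m • ⊤ : Submodule P P)] := by
    intro m n hmn
    rw [SModEq.sub_mem, smul_eq_mul, Ideal.mul_top]
    induction n, hmn using Nat.le_induction with
    | base => simp
    | succ n hmn ih =>
      rw [← sub_add_sub_cancel _ (u n)]
      exact (I ^ m).add_mem ih (Ideal.pow_le_pow_right hmn (hstep n))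
  obtain ⟨s, hs⟩ := IsPrecomplete.prec (I := I) inferInstance hcauchy
  have hs' : ∀ n, u n - s ∈ I ^ n := fun n => by
    simpa [SModEq.sub_mem] using hs n
  have hsI : s ∈ I := by
    have := I.sub_mem (huI 1) (by simpa using hs' 1)
    simpa using this
  have hroot : s + s ^ 2 * k.eval s + b = 0 := by
    refine IsHausdorff.haus (I := I) inferInstance _ fun n => ?_
    rw [SModEq.sub_mem, smul_eq_mul, Ideal.mul_top, sub_zero]
    have h1 := Ideal.pow_le_pow_right n.le_succ (hs' (n + 1))
    have h2 := Ideal.pow_le_pow_right n.le_succ (hcontr n _ _ (huI n) hsI (hs' n))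
    have h3 : s + s ^ 2 * k.eval s + b =
        -(u (n + 1) - s) - (u n ^ 2 * k.eval (u n) - s ^ 2 * k.eval s) := by
      rw [hu n]; ring
    rw [h3]
    exact (I ^ n).sub_mem ((I ^ n).neg_mem h1) h2
  refine ⟨s, hroot, ?_⟩
  have hunit : IsUnit (s * k.eval s + 1) := by
    have := Ideal.mem_jacobson_bot.1 (IsAdicComplete.le_jacobson_bot I hsI) (k.eval s)
    exact this
  obtain ⟨w, hw⟩ := hunit.exists_right_inv
  refine ⟨-w, ?_⟩
  linear_combination w * hroot - s * hw

/-- A form of Newton's lemma: an approximate root of quality `w² x`, where `w` is a multiple of the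
derivative, is congruent to a root modulo `w x`. -/
theorem exists_root_of_sq_derivative_dvd {P : Type*} [CommRing P] (I : Ideal P)
    [IsAdicComplete I P] (F : Polynomial P) {θ w v x q : P} (hx : x ∈ I)
    (hw : w = F.derivative.eval θ * v) (hF : F.eval θ = w ^ 2 * x * q) :
    ∃ z, F.eval (θ + w * x * z) = 0 := by
  set c := F.derivative.eval θ with hc
  obtain ⟨k, hk⟩ := (F.map Polynomial.C).binomExpansion (Polynomial.C θ)
    (Polynomial.C c * Polynomial.X)
  obtain ⟨s, hs, t, ht⟩ := exists_add_sq_mul_eval_add_eq_zero I k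
    (b := v ^ 2 * x * q) (I.mul_mem_right _ (I.mul_mem_left _ hx))
  refine ⟨v * q * t, ?_⟩
  have h := congrArg (Polynomial.eval s) hk
  rw [Polynomial.derivative_map, Polynomial.eval_map, Polynomial.eval_map, Polynomial.eval_map,
    ← Polynomial.coe_evalRingHom, Polynomial.hom_eval₂] at h
  simp only [map_add, map_mul, map_pow, Polynomial.hom_eval₂, Polynomial.coe_evalRingHom,
    Polynomial.eval_C, Polynomial.eval_X] at h
  have hid : (Polynomial.evalRingHom s).comp Polynomial.C = RingHom.id P := by
    ext; simp
  simp only [hid, Polynomial.eval₂_id, hF, ← hc] at h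
  have harg : θ + w * x * (v * q * t) = θ + c * s := by
    rw [ht, hw]; ring
  rw [harg, h, hw]
  linear_combination c ^ 2 * hs

namespace MvPowerSeries

theorem map_coe_idealOfVars (σ R : Type*) [CommRing R] :
    (MvPolynomial.idealOfVars σ R).map (MvPolynomial.coeToMvPowerSeries.ringHom (R := R)) =
      Ideal.span (Set.range X) := by
  rw [MvPolynomial.idealOfVars, Ideal.map_span, ← Set.range_comp]
  congr 2
  ext1 i
  simp

theorem coeff_eq_zero_of_mem_span_X_pow {σ R : Type*} [Finite σ] [CommRing R] {n : ℕ}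
    {f : MvPowerSeries σ R} (hf : f ∈ Ideal.span (Set.range (X (R := R))) ^ n) {e : σ →₀ ℕ}
    (he : e.degree < n) : coeff e f = 0 := by
  let g : MvPowerSeries σ R →+* MvPolynomial σ R ⧸ MvPolynomial.idealOfVars σ R ^ n :=
    (truncTotalAlgHom σ R n).toRingHom
  have h : g f ∈ (Ideal.span (Set.range (X (R := R))) ^ n).map g := Ideal.mem_map_of_mem g hf
  have h2 : (Ideal.span (Set.range (X (R := R)))).map g =
      (MvPolynomial.idealOfVars σ R).map (Ideal.Quotient.mk _) := by
    rw [← map_coe_idealOfVars, Ideal.map_map]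
    congr 1
    exact RingHom.ext fun p => (truncTotalAlgHom σ R n).commutes p
  rw [Ideal.map_pow, h2, ← Ideal.map_pow, Ideal.map_quotient_self, Ideal.mem_bot] at h
  have h3 := Ideal.Quotient.eq_zero_iff_mem.1 h
  rw [← coeff_truncTotal f he]
  exact (MvPolynomial.mem_pow_idealOfVars_iff' n _).1 h3 e he

theorem sub_truncTotal_mem_span_X_pow {σ R : Type*} [Finite σ] [CommRing R] (n : ℕ)
    (f : MvPowerSeries σ R) :
    f - (truncTotal n f : MvPolynomial σ R) ∈ Ideal.span (Set.range (X (R := R))) ^ n := by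
  set I := Ideal.span (Set.range (X (σ := σ) (R := R)))
  have hc : ∀ {m k : ℕ}, m ≤ k → ((truncTotal m f : MvPolynomial σ R) : MvPowerSeries σ R) ≡
      (truncTotal k f : MvPolynomial σ R) [SMOD 
        (I ^ m • ⊤ : Submodule (MvPowerSeries σ R) (MvPowerSeries σ R))] := by
    intro m k hmk
    rw [SModEq.sub_mem, smul_eq_mul, Ideal.mul_top]
    have h := Ideal.mem_map_of_mem (MvPolynomial.coeToMvPowerSeries.ringHom (R := R))
      (truncTotal_sub_truncTotal_mem_pow_idealOfVars le_rfl hmk f)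
    rw [Ideal.map_pow, map_coe_idealOfVars, map_sub] at h
    exact h
  obtain ⟨L, hL⟩ := IsPrecomplete.prec (I := I) inferInstance hc
  have hL' : ∀ m, ((truncTotal m f : MvPolynomial σ R) : MvPowerSeries σ R) - L ∈ I ^ m :=
      fun m => by
    simpa [SModEq.sub_mem] using hL m
  have hfL : f = L := by
    ext e
    have h := coeff_eq_zero_of_mem_span_X_pow (hL' (e.degree + 1)) (Nat.lt_succ_self _)
    rw [map_sub, sub_eq_zero, MvPolynomial.coeff_coe, coeff_truncTotal _ (Nat.lt_succ_self _)] at h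
    exact h
  have h := hL' n
  rw [← hfL] at h
  rw [← neg_sub]
  exact (I ^ n).neg_mem h

end MvPowerSeries

theorem MvPolynomial.IsHomogeneous.exists_int_eval_cons_ne_zero {K : Type*} [Field K] [CharZero K]
    {d n : ℕ} {P : MvPolynomial (Fin (d + 1)) K} (hP : P.IsHomogeneous n) (hP0 : P ≠ 0) :
    ∃ c : Fin d → ℤ,
      MvPolynomial.eval (Fin.cons 1 (fun i => (c i : K)) : Fin (d + 1) → K) P ≠ 0 := by
  by_contra! h
  let g : MvPolynomial (Fin (d + 1)) K →ₐ[K] MvPolynomial (Fin d) K :=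
    MvPolynomial.aeval (Fin.cons 1 MvPolynomial.X : Fin (d + 1) → MvPolynomial (Fin d) K)
  have hg : ∀ (y : Fin d → K), MvPolynomial.eval y (g P) =
      MvPolynomial.eval (Fin.cons 1 y : Fin (d + 1) → K) P := by
    intro y
    suffices H : (MvPolynomial.eval y).comp g.toRingHom =
        MvPolynomial.eval (Fin.cons 1 y : Fin (d + 1) → K) from congrArg (· P) H
    refine MvPolynomial.ringHom_ext (fun r => by simp [g]) fun i => ?_
    refine Fin.cases ?_ (fun i => ?_) i <;> simp [g]
  have hgP : g P = 0 := by
    refine MvPolynomial.funext_set (fun _ => Set.range (Int.cast : ℤ → K))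
      (fun _ => Set.infinite_range_of_injective Int.cast_injective) fun y hy => ?_
    choose c hc using fun i => hy i (Set.mem_univ i)
    rw [hg, map_zero, ← h c]
    congr 2
    ext i
    refine Fin.cases rfl (fun i => ?_) i
    simp [hc]
  refine hP0 (MvPolynomial.funext_set (fun _ => ({0}ᶜ : Set K))
    (fun _ => (Set.finite_singleton _).infinite_compl) fun y hy => ?_)
  have hy0 : y 0 ≠ 0 := hy 0 (Set.mem_univ 0)
  have h1 := hg (fun i => (y 0)⁻¹ * y i.succ)
  have h2 : y = y 0 • (Fin.cons 1 (fun i => (y 0)⁻¹ * y i.succ) : Fin (d + 1) → K) := by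
    ext i
    refine Fin.cases (by simp) (fun i => ?_) i
    simp [hy0]
  have h3 : ∀ (t : K) (z : Fin (d + 1) → K),
      MvPolynomial.eval (t • z) P = t ^ n * MvPolynomial.eval z P := by
    intro t z
    rw [MvPolynomial.eval_eq', MvPolynomial.eval_eq', Finset.mul_sum]
    refine Finset.sum_congr rfl fun e he => ?_
    have hdeg : ∑ i, e i = n := by
      have := hP (MvPolynomial.mem_support_iff.1 he)
      rwa [Pi.one_def, ← Finsupp.degree_eq_weight_one, Finsupp.degree_eq_sum] at this
    simp_rw [Pi.smul_apply, smul_eq_mul, mul_pow, Finset.prod_mul_distrib,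
      Finset.prod_pow_eq_pow_sum, hdeg]
    ring
  rw [h2, map_zero, h3, ← h1, hgP, map_zero, mul_zero]

namespace MvPowerSeries

/-- The automorphism `X (i + 1) ↦ X (i + 1) + c i * X 0` of a power series ring. -/
noncomputable def shearVec {K : Type*} [CommRing K] {d : ℕ} (c : Fin d → ℤ) :
    Fin (d + 1) → MvPowerSeries (Fin (d + 1)) K :=
  Fin.cons (X 0) fun i => X i.succ + (c i : MvPowerSeries (Fin (d + 1)) K) * X 0

theorem hasSubst_shearVec {K : Type*} [CommRing K] {d : ℕ} (c : Fin d → ℤ) :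
    HasSubst (shearVec (K := K) c) := by
  refine hasSubst_of_constantCoeff_zero fun i => ?_
  refine Fin.cases ?_ (fun i => ?_) i <;> simp [shearVec]

theorem substAlgHom_shearVec_neg {K : Type*} [CommRing K] {d : ℕ} (c : Fin d → ℤ) :
    (substAlgHom (R := K) (hasSubst_shearVec c)).comp (substAlgHom (hasSubst_shearVec (-c))) =
      AlgHom.id K _ := by
  have h : (fun s => subst (shearVec (K := K) c) (shearVec (K := K) (-c) s)) = X := by
    ext1 i
    rw [← substAlgHom_apply (hasSubst_shearVec c)]
    refine Fin.cases ?_ (fun i => ?_) i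
    · change substAlgHom (hasSubst_shearVec c) (X 0) = X 0
      rw [substAlgHom_X]
      rfl
    · change substAlgHom (hasSubst_shearVec c)
        (X i.succ + ((-c) i : MvPowerSeries (Fin (d + 1)) K) * X 0) = X i.succ
      rw [map_add, map_mul, map_intCast, substAlgHom_X, substAlgHom_X]
      simp [shearVec]
  refine AlgHom.ext fun f => ?_
  rw [AlgHom.comp_apply, substAlgHom_apply, substAlgHom_apply,
    subst_comp_subst_apply (hasSubst_shearVec (-c)) (hasSubst_shearVec c), h, subst_self]
  rfl

/-- In suitable coordinates, a nonzero power series is regular in the first variable. -/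
theorem exists_ringEquiv_powerSeries {K : Type*} [Field K] [CharZero K] {d : ℕ}
    (δ : MvPowerSeries (Fin (d + 1)) K) (hδ : δ ≠ 0) :
    ∃ (c : Fin d → ℤ) (Θ : MvPowerSeries (Fin (d + 1)) K ≃+* PowerSeries (MvPowerSeries (Fin d) K)),
      Θ (X 0) = PowerSeries.X ∧
      (∀ i : Fin d, Θ (X i.succ) = PowerSeries.C (X i) + (c i : PowerSeries _) * PowerSeries.X) ∧
      (∀ a : K, Θ (C a) = PowerSeries.C (C a)) ∧
      ∃ n, constantCoeff (PowerSeries.coeff n (Θ δ)) ≠ 0 := by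
  have hord : ((δ.order.toNat : ℕ) : ℕ∞) = δ.order :=
    ENat.natCast_toNat (by rwa [Ne, order_eq_top_iff])
  set n := δ.order.toNat with hn
  set P := truncTotal (n + 1) δ with hPdef
  have hPhom : P.IsHomogeneous n := by
    intro e he
    rw [Pi.one_def, ← Finsupp.degree_eq_weight_one]
    rw [hPdef] at he
    by_contra hne
    rcases lt_or_gt_of_ne hne with hlt | hgt
    · rw [coeff_truncTotal _ (by omega)] at he
      exact he (coeff_of_lt_order (by rw [← hord]; exact_mod_cast hlt))
    · exact he (coeff_truncTotal_eq_zero _ (by omega))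
  have hP0 : P ≠ 0 := by
    obtain ⟨e, he, hde⟩ := exists_coeff_ne_zero_and_order hord
    have hde' : e.degree = n := by
      rw [← hord] at hde
      exact_mod_cast hde
    intro h0
    apply he
    rw [← coeff_truncTotal δ (n := n + 1) (by omega), ← hPdef, h0, MvPolynomial.coeff_zero]
  obtain ⟨c, hc⟩ := hPhom.exists_int_eval_cons_ne_zero hP0
  let σ : MvPowerSeries (Fin (d + 1)) K ≃ₐ[K] MvPowerSeries (Fin (d + 1)) K :=
    AlgEquiv.ofAlgHom (substAlgHom (hasSubst_shearVec c)) (substAlgHom (hasSubst_shearVec (-c)))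
      (substAlgHom_shearVec_neg c) (by simpa using substAlgHom_shearVec_neg (K := K) (-c))
  let Θ := (σ.trans (finSuccEquiv K d)).toRingEquiv
  have hσX : ∀ i, σ (X i) = shearVec c i := fun i => substAlgHom_X (hasSubst_shearVec c) i
  have hΘ0 : Θ (X 0) = PowerSeries.X := by
    change finSuccEquiv K d (σ (X 0)) = _
    rw [hσX]
    simp [shearVec, finSuccEquiv_X_zero]
  have hΘs : ∀ i : Fin d,
      Θ (X i.succ) = PowerSeries.C (X i) + (c i : PowerSeries _) * PowerSeries.X := by
    intro i
    change finSuccEquiv K d (σ (X i.succ)) = _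
    rw [hσX]
    simp [shearVec, finSuccEquiv_X_zero, finSuccEquiv_X_succ]
  have hΘC : ∀ a : K, Θ (C a) = PowerSeries.C (C a) := by
    intro a
    change finSuccEquiv K d (σ (C a)) = _
    have h : σ (C a) = C a := by
      rw [c_eq_algebraMap, AlgEquiv.commutes]
    rw [h, finSuccEquiv_C]
  refine ⟨c, Θ, hΘ0, hΘs, hΘC, n, ?_⟩
  let ρ : MvPowerSeries (Fin (d + 1)) K →+* PowerSeries K :=
    (PowerSeries.map constantCoeff).comp Θ.toRingHom
  set a : Fin (d + 1) → K := Fin.cons 1 fun i => (c i : K) with ha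
  have hρX : ∀ i, ρ (X i) = PowerSeries.C (a i) * PowerSeries.X := by
    intro i
    refine Fin.cases ?_ (fun i => ?_) i
    · simp [ρ, hΘ0, ha]
    · simp [ρ, hΘs, ha]
  have hρC : ∀ r : K, ρ (C r) = PowerSeries.C r := by
    intro r
    simp [ρ, hΘC]
  have hρP : ρ (P : MvPowerSeries (Fin (d + 1)) K) =
      PowerSeries.C (MvPolynomial.eval a P) * PowerSeries.X ^ n := by
    have h1 : ρ.comp MvPolynomial.coeToMvPowerSeries.ringHom =
        MvPolynomial.eval₂Hom PowerSeries.C fun i => PowerSeries.C (a i) * PowerSeries.X := by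
      refine MvPolynomial.ringHom_ext (fun r => ?_) fun i => ?_
      · simp [hρC]
      · simp [hρX]
    have h2 := congrArg (· P) h1
    simp only [RingHom.comp_apply] at h2
    refine h2.trans ?_
    rw [MvPolynomial.coe_eval₂Hom, MvPolynomial.eval₂_eq', MvPolynomial.eval_eq', map_sum,
      Finset.sum_mul]
    refine Finset.sum_congr rfl fun e he => ?_
    have hdeg : ∑ i, e i = n := by
      have := hPhom (MvPolynomial.mem_support_iff.1 he)
      rwa [Pi.one_def, ← Finsupp.degree_eq_weight_one, Finsupp.degree_eq_sum] at this
    rw [map_mul, map_prod, mul_assoc]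
    congr 1
    simp_rw [mul_pow, Finset.prod_mul_distrib, Finset.prod_pow_eq_pow_sum, hdeg, map_pow]
  have hρr : PowerSeries.coeff n (ρ (δ - (P : MvPowerSeries (Fin (d + 1)) K))) = 0 := by
    have h1 := Ideal.mem_map_of_mem ρ (sub_truncTotal_mem_span_X_pow (n + 1) δ)
    rw [Ideal.map_pow] at h1
    have h2 : (Ideal.span (Set.range (X (σ := Fin (d + 1)) (R := K)))).map ρ ≤
        Ideal.span {PowerSeries.X} := by
      rw [Ideal.map_span, Ideal.span_le]
      rintro _ ⟨_, ⟨i, rfl⟩, rfl⟩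
      rw [hρX]
      exact Ideal.mul_mem_left _ _ (Ideal.mem_span_singleton_self _)
    have h3 := Ideal.pow_right_mono h2 (n + 1) h1
    rw [Ideal.span_singleton_pow, Ideal.mem_span_singleton] at h3
    exact PowerSeries.X_pow_dvd_iff.1 h3 n (Nat.lt_succ_self n)
  have h := hρr
  rw [map_sub, map_sub, hρP, PowerSeries.coeff_C_mul, PowerSeries.coeff_X_pow_self, mul_one,
    sub_eq_zero] at h
  have h' : constantCoeff (PowerSeries.coeff n (Θ δ)) = PowerSeries.coeff n (ρ δ) := by
    simp [ρ]
  rw [h', h]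
  exact hc

end MvPowerSeries

namespace PowerSeries

theorem coeff_mem_of_mem_map_C {R : Type*} [CommRing R] {I : Ideal R} {a : PowerSeries R}
    (ha : a ∈ I.map C) (n : ℕ) : coeff n a ∈ I := by
  suffices H : ∀ n, coeff n a ∈ I from H n
  refine Submodule.span_induction (p := fun e _ => ∀ n, coeff n e ∈ I) ?_ (by simp) ?_ ?_ ha
  · rintro _ ⟨r, hr, rfl⟩ n
    rw [coeff_C]
    split_ifs
    exacts [hr, I.zero_mem]
  · intro u v _ _ hu hv n
    rw [map_add]
    exact I.add_mem (hu n) (hv n)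
  · intro r u _ hu n
    rw [smul_eq_mul, coeff_mul]
    exact I.sum_mem fun _ _ => I.mul_mem_left _ (hu _)

theorem mem_span_X_pow_sup_map_C {R : Type*} [CommRing R] {I : Ideal R} {q : ℕ}
    {a : PowerSeries R} :
    a ∈ Ideal.span {(X : PowerSeries R) ^ q} ⊔ I.map C ↔ ∀ n < q, coeff n a ∈ I := by
  constructor
  · intro ha n hn
    obtain ⟨b, hb, e, he, rfl⟩ := Submodule.mem_sup.1 ha
    rw [map_add]
    refine I.add_mem ?_ (coeff_mem_of_mem_map_C he n)
    obtain ⟨b', rfl⟩ := Ideal.mem_span_singleton.1 hb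
    rw [coeff_X_pow_mul', if_neg (by omega)]
    exact I.zero_mem
  · intro h
    rw [eq_X_pow_mul_shift_add_trunc q a]
    refine Ideal.add_mem _ ?_ ?_
    · exact Ideal.mem_sup_left (Ideal.mul_mem_right _ _ (Ideal.mem_span_singleton_self _))
    · refine Ideal.mem_sup_right ?_
      rw [trunc_apply, ← Polynomial.coeToPowerSeries.ringHom_apply, map_sum]
      refine Ideal.sum_mem _ fun n hn => ?_
      rw [← Polynomial.C_mul_X_pow_eq_monomial, map_mul]
      refine Ideal.mul_mem_right _ _ ?_
      rw [Polynomial.coeToPowerSeries.ringHom_apply, Polynomial.coe_C]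
      exact Ideal.mem_map_of_mem C (h n (by simpa using hn))

end PowerSeries

open PowerSeries in
theorem FrobeniusRegular.powerSeries {p : ℕ} (hp : p.Prime) {R : Type} [CommRing R]
    (hpR : (p : R) = 0) {d : ℕ} {x : Fin d → R} (hx : FrobeniusRegular p x) (c : Fin d → ℤ) :
    FrobeniusRegular p (Fin.cons (X : PowerSeries R)
      (fun i => C (x i) + (c i : PowerSeries R) * X) : Fin (d + 1) → PowerSeries R) := by
  by_cases hR : Subsingleton R
  · have : Subsingleton (PowerSeries R) := ⟨fun a b => by ext; exact Subsingleton.elim _ _⟩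
    refine ⟨fun e k a _ => ?_, fun a _ => Subsingleton.elim a 0⟩
    rw [Subsingleton.elim a 0]
    exact Ideal.zero_mem _
  rw [not_subsingleton_iff_nontrivial] at hR
  have hpS : ((p : ℕ) : PowerSeries R) = 0 := by
    rw [← map_natCast (C : R →+* PowerSeries R), hpR, map_zero]
  have : CharP (PowerSeries R) p := (CharP.charP_iff_prime_eq_zero hp).2 hpS
  have : Fact p.Prime := ⟨hp⟩
  refine ⟨fun e k a => ?_, fun a ha => ?_⟩
  · set q := p ^ e with hq
    refine Fin.cases ?_ (fun k => ?_) k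
    · intro h
      rw [show {j : Fin (d + 1) | j < 0} = ∅ by ext j; simp, Set.image_empty, Ideal.span_empty,
        Ideal.mem_bot] at h ⊢
      have h' : X ^ q * a = X ^ q * 0 := by simpa using h
      exact X_pow_mul_cancel h'
    · set I := Ideal.span ((fun j => x j ^ q) '' {j | j < k}) with hI
      have hpow : ∀ i, (C (x i) + (c i : PowerSeries R) * X) ^ q =
          C (x i ^ q) + (c i : PowerSeries R) ^ q * X ^ q := by
        intro i
        rw [hq, add_pow_char_pow, mul_pow, map_pow]
      have hJ : Ideal.span ((fun j => (Fin.cons (X : PowerSeries R)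
          (fun i => C (x i) + (c i : PowerSeries R) * X) : Fin (d + 1) → PowerSeries R) j ^ q) ''
            {j | j < k.succ}) = Ideal.span {(X : PowerSeries R) ^ q} ⊔ I.map C := by
        apply le_antisymm
        · rw [Ideal.span_le]
          rintro _ ⟨j, hj, rfl⟩
          induction j using Fin.cases with
          | zero => exact Ideal.mem_sup_left (Ideal.mem_span_singleton_self _)
          | succ j =>
            have hjk : j < k := by simpa using hj
            change (C (x j) + (c j : PowerSeries R) * X) ^ q ∈ _
            rw [hpow]
            refine Ideal.add_mem _ (Ideal.mem_sup_right (Ideal.mem_map_of_mem C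
              (Ideal.subset_span ⟨j, hjk, rfl⟩)))
                (Ideal.mul_mem_left _ _ (Ideal.mem_sup_left (Ideal.mem_span_singleton_self _)))
        · have hX : (X : PowerSeries R) ^ q ∈ Ideal.span ((fun j => (Fin.cons (X : PowerSeries R)
              (fun i => C (x i) + (c i : PowerSeries R) * X) : Fin (d + 1) → PowerSeries R) j ^ q)
                '' {j | j < k.succ}) :=
            Ideal.subset_span ⟨0, Fin.succ_pos k, rfl⟩
          refine sup_le ((Ideal.span_singleton_le_iff_mem _).2 hX) ?_
          rw [hI, Ideal.map_span, Ideal.span_le]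
          rintro _ ⟨_, ⟨j, hj, rfl⟩, rfl⟩
          have h := hpow j
          rw [← sub_eq_iff_eq_add] at h
          change C (x j ^ q) ∈ _
          rw [← h]
          refine Ideal.sub_mem _ (Ideal.subset_span ⟨j.succ, ?_, rfl⟩) (Ideal.mul_mem_left _ _ hX)
          simpa using hj
      rw [hJ]
      intro h
      change (C (x k) + (c k : PowerSeries R) * X) ^ q * a ∈ _ at h
      rw [hpow, add_mul] at h
      have h2 := (Ideal.add_mem_iff_left _ (by
        rw [mul_right_comm, mul_comm]
        exact Ideal.mem_sup_left (Ideal.mul_mem_right _ _ (Ideal.mem_span_singleton_self _)))).1 h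
      rw [mem_span_X_pow_sup_map_C] at h2 ⊢
      intro n hn
      have h3 := h2 n hn
      rw [coeff_C_mul] at h3
      exact hx.regular e k _ h3
  · set I := Ideal.span (Set.range x) with hI
    have hpow : ∀ n, ∀ b ∈ Ideal.span (Set.range (Fin.cons (X : PowerSeries R)
        (fun i => C (x i) + (c i : PowerSeries R) * X) : Fin (d + 1) → PowerSeries R)) ^ n,
        ∀ m, coeff m b ∈ I ^ (n - m) := by
      intro n
      induction n with
      | zero => simp
      | succ n ih =>
        intro b hb
        rw [pow_succ'] at hb
        refine Submodule.mul_induction_on hb (fun r hr s hs m => ?_) (fun u v hu hv m => ?_)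
        · have hr0 : coeff 0 r ∈ I := by
            rw [coeff_zero_eq_constantCoeff_apply, ← Ideal.mem_comap]
            refine (Ideal.span_le.2 ?_) hr
            rintro _ ⟨i, rfl⟩
            induction i using Fin.cases with
            | zero => simp
            | succ i => simpa using Ideal.subset_span (Set.mem_range_self i)
          rw [coeff_mul]
          refine Ideal.sum_mem _ fun ij hij => ?_
          obtain ⟨i, j⟩ := ij
          rw [Finset.HasAntidiagonal.mem_antidiagonal] at hij
          dsimp only at hij ⊢
          rcases Nat.eq_zero_or_pos i with rfl | hi
          · rw [zero_add] at hij
            subst hij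
            have h := Ideal.mul_mem_mul hr0 (ih s hs j)
            rw [← pow_succ'] at h
            exact Ideal.pow_le_pow_right (by omega) h
          · exact Ideal.mul_mem_left _ _ (Ideal.pow_le_pow_right (by omega) (ih s hs j))
        · rw [map_add]
          exact Ideal.add_mem _ (hu m) (hv m)
    ext m
    refine hx.separated _ fun n => ?_
    have h := hpow (n + m) a (ha _) m
    rwa [Nat.add_sub_cancel] at h

theorem Int.isJacobsonRing : IsJacobsonRing ℤ := by
  rw [isJacobsonRing_iff_prime_eq]
  intro I hI
  by_cases h : I = ⊥
  · subst h
    refine le_antisymm (fun x hx => ?_) Ideal.le_jacobson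
    rw [Ideal.mem_jacobson_bot] at hx
    rw [Ideal.mem_bot]
    by_contra hx0
    have h1 := hx (3 * x)
    have h2 : 0 < x * x := mul_self_pos.2 hx0
    rcases Int.isUnit_iff.1 h1 with h1 | h1 <;> nlinarith
  · have : I.IsMaximal := IsPrime.to_maximal_ideal h
    exact Ideal.jacobson_eq_self_of_isMaximal

theorem exists_prime_ringHom_closure {K : Type} [Field K] {T : Set K}
    (hT : T.Finite) (β : Subring.closure T) (hβ : β ≠ 0) :
    ∃ (p : ℕ) (R : Type) (_ : Field R) (φ : Subring.closure T →+* R),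
      p.Prime ∧ (p : R) = 0 ∧ φ β ≠ 0 := by
  have := Int.isJacobsonRing
  set T' : Set K := insert (β : K)⁻¹ T with hT'
  have hft : Algebra.FiniteType ℤ (subalgebraOfSubring (Subring.closure T')) := by
    rw [← Subalgebra.fg_iff_finiteType, ← Algebra.adjoin_int]
    exact ⟨(hT.insert (β : K)⁻¹).toFinset, by simp [hT']⟩
  let g : Subring.closure T →+* subalgebraOfSubring (Subring.closure T') :=
    (Subring.closure T).subtype.codRestrict _ fun a =>
      Subring.closure_mono (Set.subset_insert _ _) a.2
  obtain ⟨m, hm⟩ := Ideal.exists_maximal (subalgebraOfSubring (Subring.closure T'))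
  let _ : Field (subalgebraOfSubring (Subring.closure T') ⧸ m) := Ideal.Quotient.field m
  have hft' : Algebra.FiniteType ℤ (subalgebraOfSubring (Subring.closure T') ⧸ m) :=
    Algebra.FiniteType.of_surjective (Ideal.Quotient.mkₐ ℤ m) (Ideal.Quotient.mkₐ_surjective _ _)
  have hfin := finite_of_finite_type_of_isJacobsonRing ℤ
    (subalgebraOfSubring (Subring.closure T') ⧸ m)
  obtain ⟨p, hp⟩ := CharP.exists (subalgebraOfSubring (Subring.closure T') ⧸ m)
  refine ⟨p, _, inferInstance, (Ideal.Quotient.mk m).comp g, ?_, ?_, ?_⟩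
  · rcases CharP.char_is_prime_or_zero (subalgebraOfSubring (Subring.closure T') ⧸ m) p with h | h
    · exact h
    · subst h
      have : CharZero (subalgebraOfSubring (Subring.closure T') ⧸ m) := CharP.charP_to_charZero _
      exact (Int.not_isField (isField_of_isIntegral_of_isField
        (FaithfulSMul.algebraMap_injective ℤ (subalgebraOfSubring (Subring.closure T') ⧸ m))
        (Field.toIsField _))).elim
  · exact CharP.cast_eq_zero _ p
  · rw [RingHom.comp_apply, Ne, Ideal.Quotient.eq_zero_iff_mem]
    intro h
    have hu : g β *
        ⟨(β : K)⁻¹, Subring.subset_closure (Set.mem_insert _ _)⟩ = 1 := by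
      ext
      exact mul_inv_cancel₀ (fun h0 => hβ (Subtype.ext h0))
    exact hm.ne_top ((Ideal.eq_top_iff_one _).2 (hu ▸ m.mul_mem_right _ h))

/-- Finitely generated subrings of `S` specialise to domains of positive characteristic in which
the images of the elements `x i` form a regular sequence. -/
def HasFrobeniusModels {S : Type} [CommRing S] {d : ℕ} (x : Fin d → S) : Prop :=
  ∀ T : Set S, T.Finite → ∀ β : Subring.closure T, β ≠ 0 →
    ∃ (p : ℕ) (R : Type) (_ : CommRing R) (_ : IsDomain R) (φ : Subring.closure T →+* R)
      (y : Fin d → R), p.Prime ∧ (p : R) = 0 ∧ FrobeniusRegular p y ∧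
        (∀ (a : Subring.closure T) i, (a : S) = x i → φ a = y i) ∧ φ β ≠ 0

theorem HasFrobeniusModels.of_field_equiv {S K : Type} [CommRing S] [Field K] (e : S ≃+* K)
    (x : Fin 0 → S) : HasFrobeniusModels x := by
  intro T hT β hβ
  let g : Subring.closure T →+* Subring.closure (e.toRingHom '' T) :=
    (e.toRingHom.comp (Subring.closure T).subtype).codRestrict _ fun a => by
      rw [← RingHom.map_closure]
      exact ⟨a, a.2, rfl⟩
  have hg : g β ≠ 0 := by
    intro h
    apply hβ
    have h' : e β = 0 := congrArg Subtype.val h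
    exact Subtype.ext ((map_eq_zero_iff e e.injective).1 h')
  obtain ⟨p, R, _, φ, hp, hpR, hφ⟩ := exists_prime_ringHom_closure (hT.image _) (g β) hg
  refine ⟨p, R, inferInstance, inferInstance, φ.comp g, Fin.elim0, hp, hpR,
    ⟨fun _ k => k.elim0, fun a ha => ?_⟩, fun _ i => i.elim0, hφ⟩
  simpa using ha 1

namespace Polynomial.IsDistinguishedAt

variable {S : Type*} [CommRing S] {I : Ideal S} [IsAdicComplete I S] {m : Polynomial S}

theorem dvd_of_coe_dvd_coe (hm : m.IsDistinguishedAt I) {g : Polynomial S}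
    (h : (m : PowerSeries S) ∣ (g : PowerSeries S)) : m ∣ g := by
  rw [← Ideal.mem_span_singleton, ← Ideal.Quotient.eq_zero_iff_mem] at h ⊢
  refine (map_eq_zero_iff hm.algEquivQuotient hm.algEquivQuotient.injective).1 ?_
  exact h

theorem exists_dvd_sub_coe (hm : m.IsDistinguishedAt I) (g : PowerSeries S) :
    ∃ g₀ : Polynomial S, (m : PowerSeries S) ∣ (g₀ : PowerSeries S) - g := by
  obtain ⟨b, hb⟩ := hm.algEquivQuotient.surjective (Ideal.Quotient.mk _ g)
  obtain ⟨g₀, rfl⟩ := Ideal.Quotient.mk_surjective b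
  refine ⟨g₀, ?_⟩
  rw [← Ideal.mem_span_singleton, ← Ideal.Quotient.eq]
  exact hb

end Polynomial.IsDistinguishedAt

open Polynomial in
theorem exists_polynomial_approximation {S σ : Type*} [CommRing S] [IsDomain S] [IsLocalRing S]
    [IsAdicComplete (IsLocalRing.maximalIdeal S) S] (y : σ → PowerSeries S) (θ : PowerSeries S)
    (f G : Polynomial (MvPolynomial σ ℤ)) (hf : evalPoly y θ f = 0)
    (hG : ∃ n, IsUnit (PowerSeries.coeff n (evalPoly y θ G))) :
    ∃ (y₀ : σ → Polynomial S) (θ₀ w U q : Polynomial S), w.Monic ∧ IsUnit (U.coeff 0) ∧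
      evalPoly y₀ θ₀ G = w * U ∧ evalPoly y₀ θ₀ f = w ^ 2 * X * q ∧
      (∀ i (r : Polynomial S), y i = r → y₀ i = r) ∧
      ∀ h, evalPoly y θ G ∣ evalPoly y θ h → w ∣ evalPoly y₀ θ₀ h := by
  obtain ⟨n, hn⟩ := hG
  have hG' : (evalPoly y θ G).map (IsLocalRing.residue S) ≠ 0 := by
    intro h
    have h1 := congrArg (PowerSeries.coeff n) h
    rw [PowerSeries.coeff_map, map_zero] at h1
    exact (hn.map (IsLocalRing.residue S)).ne_zero h1
  obtain ⟨w, u, hw, hu, hwu⟩ := PowerSeries.exists_isWeierstrassFactorization hG'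
  have hX : (X : Polynomial S).IsDistinguishedAt (IsLocalRing.maximalIdeal S) := by
    refine ⟨⟨fun {n} hn => ?_⟩, monic_X⟩
    rw [natDegree_X, Nat.lt_one_iff] at hn
    simp [hn]
  have hm : (w ^ 2 * X).IsDistinguishedAt (IsLocalRing.maximalIdeal S) := by
    rw [pow_two]
    exact (hw.mul hw).mul hX
  have happ : ∀ g : PowerSeries S, ∃ g₀ : Polynomial S,
      ((w ^ 2 * X : Polynomial S) : PowerSeries S) ∣ (g₀ : PowerSeries S) - g ∧
        ∀ r : Polynomial S, g = r → g₀ = r := by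
    intro g
    by_cases hg : ∃ r : Polynomial S, g = r
    · obtain ⟨r, rfl⟩ := hg
      exact ⟨r, by simp, fun r' h => coe_injective S h⟩
    · obtain ⟨g₀, h⟩ := hm.exists_dvd_sub_coe g
      exact ⟨g₀, h, fun r hr => (hg ⟨r, hr⟩).elim⟩
  choose y₀ hy₀ hy₀' using fun i => happ (y i)
  obtain ⟨θ₀, hθ₀, -⟩ := happ θ
  have hev : ∀ h, ((w ^ 2 * X : Polynomial S) : PowerSeries S) ∣
      (evalPoly y₀ θ₀ h : PowerSeries S) - evalPoly y θ h := by
    intro h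
    have h1 := map_evalPoly (coeToPowerSeries.ringHom (R := S)) y₀ θ₀ h
    rw [coeToPowerSeries.ringHom_apply] at h1
    rw [h1, ← Ideal.mem_span_singleton]
    exact evalPoly_sub_mem _ (fun i => Ideal.mem_span_singleton.2 (hy₀ i))
      (Ideal.mem_span_singleton.2 hθ₀) h
  have hwm : (w : PowerSeries S) ∣ ((w ^ 2 * X : Polynomial S) : PowerSeries S) :=
    ⟨(w : PowerSeries S) * PowerSeries.X, by push_cast; ring⟩
  have hwd : ∀ h, evalPoly y θ G ∣ evalPoly y θ h → w ∣ evalPoly y₀ θ₀ h := by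
    intro h hh
    apply hw.dvd_of_coe_dvd_coe
    have h1 : (w : PowerSeries S) ∣ evalPoly y θ h := (Dvd.intro u hwu.symm).trans hh
    exact (dvd_sub_left h1).1 (hwm.trans (hev h))
  obtain ⟨U, hU⟩ := hwd G dvd_rfl
  have hfm : (w ^ 2 * X) ∣ evalPoly y₀ θ₀ f := by
    apply hm.dvd_of_coe_dvd_coe
    simpa [hf] using hev f
  obtain ⟨q, hq⟩ := hfm
  refine ⟨y₀, θ₀, w, U, q, hw.monic, ?_, hU, hq, hy₀', hwd⟩
  obtain ⟨z, hz⟩ := hev G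
  have hw0 : (w : PowerSeries S) ≠ 0 := by
    rw [Ne, coe_eq_zero_iff]
    exact hw.monic.ne_zero
  have hUu : (U : PowerSeries S) = u + (w : PowerSeries S) * PowerSeries.X * z := by
    apply mul_left_cancel₀ hw0
    rw [hU, hwu] at hz
    push_cast at hz
    linear_combination hz
  have h0 := congrArg PowerSeries.constantCoeff hUu
  have h0' : U.coeff 0 = PowerSeries.constantCoeff u := by simpa using h0
  rw [h0']
  exact hu.map PowerSeries.constantCoeff

theorem exists_ringHom_of_approximate_root {Q R : Type*} [CommRing Q] [IsDomain Q] [CommRing R]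
    [IsDomain R] {s T : Set Q} {θ : Q} {f G : Polynomial (MvPolynomial s ℤ)}
    (hker : ∀ h, evalPoly (fun i : s => (i : Q)) θ h = 0 → f ∣ h)
    (hfG : Polynomial.derivative f ∣ G)
    {y : s → PowerSeries R} {θ₀ w U q : PowerSeries R} (hw0 : w ≠ 0) (hU : IsUnit U)
    (hG : evalPoly y θ₀ G = w * U) (hf : evalPoly y θ₀ f = w ^ 2 * PowerSeries.X * q)
    (hT : ∀ t ∈ T, ∃ h, evalPoly (fun i : s => (i : Q)) θ h =
      evalPoly (fun i : s => (i : Q)) θ G * t ∧ w ∣ evalPoly y θ₀ h) :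
    ∃ φ : Subring.closure T →+* PowerSeries R, (∀ (a : Subring.closure T) (i : s),
      (a : Q) = i → φ a = y i) ∧
      ∀ (a : Subring.closure T) (e : Polynomial (MvPolynomial s ℤ)),
        evalPoly (fun i : s => (i : Q)) θ e = a → e ∣ G → φ a ≠ 0 := by
  obtain ⟨U', hU'⟩ := hU.exists_right_inv
  obtain ⟨G₁, rfl⟩ := hfG
  set F : Polynomial (PowerSeries R) :=
    f.map (MvPolynomial.eval₂Hom (Int.castRingHom (PowerSeries R)) y) with hF
  have hev : ∀ ϑ, evalPoly y ϑ f = F.eval ϑ := fun ϑ => by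
    rw [hF, Polynomial.eval_map]; rfl
  have hev' : evalPoly y θ₀ (Polynomial.derivative f) = F.derivative.eval θ₀ := by
    rw [hF, Polynomial.derivative_map, Polynomial.eval_map]; rfl
  obtain ⟨z, hz⟩ := exists_root_of_sq_derivative_dvd (Ideal.span {(PowerSeries.X : PowerSeries R)})
    F (θ := θ₀) (w := w) (v := evalPoly y θ₀ G₁ * U') (x := PowerSeries.X) (q := q)
    (Ideal.mem_span_singleton_self _) (by
      rw [map_mul, hev'] at hG
      linear_combination -U' * hG - w * hU') (by rw [← hev, hf])
  set θ₁ := θ₀ + w * PowerSeries.X * z with hθ₁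
  have happ : ∀ h, ∃ b, evalPoly y θ₁ h = evalPoly y θ₀ h + w * PowerSeries.X * b := by
    intro h
    have h1 := evalPoly_sub_mem (Ideal.span {w * PowerSeries.X}) (y := y) (y' := y) (θ := θ₁)
      (θ' := θ₀) (by simp) (Ideal.mem_span_singleton.2 ⟨z, by rw [hθ₁]; ring⟩) h
    obtain ⟨b, hb⟩ := Ideal.mem_span_singleton.1 h1
    exact ⟨b, by rw [← hb]; ring⟩
  have hroot : evalPoly y θ₁ f = 0 := by rw [hev]; exact hz
  obtain ⟨b, hb⟩ := happ (Polynomial.derivative f * G₁)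
  have hunit : IsUnit (U + PowerSeries.X * b) := by
    rw [PowerSeries.isUnit_iff_constantCoeff] at hU ⊢
    simpa using hU
  obtain ⟨V, hV⟩ := hunit.exists_right_inv
  have hGw : evalPoly y θ₁ (Polynomial.derivative f * G₁) = w * (U + PowerSeries.X * b) := by
    rw [hb, hG]; ring
  have hG0 : evalPoly y θ₁ (Polynomial.derivative f * G₁) ≠ 0 := by
    rw [hGw]
    exact mul_ne_zero hw0 hunit.ne_zero
  obtain ⟨φ, hφ⟩ := exists_ringHom_closure_of_ker_le (evalPoly (fun i : s => (i : Q)) θ)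
    (evalPoly y θ₁) (fun h hh => by
      obtain ⟨r, rfl⟩ := hker h hh
      rw [map_mul, hroot, zero_mul]) _ hG0 T (fun t ht => by
      obtain ⟨h, hh, r, hr⟩ := hT t ht
      obtain ⟨b', hb'⟩ := happ h
      refine ⟨h, V * (r + PowerSeries.X * b'), hh, ?_⟩
      rw [hb', hr, hGw]
      linear_combination - w * (r + PowerSeries.X * b') * hV)
  refine ⟨φ, fun a i hai => ?_, fun a e hea he => ?_⟩
  · rw [hφ a (Polynomial.C (MvPolynomial.X i)) (by rw [evalPoly_C_X, hai]), evalPoly_C_X]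
  · rw [hφ a e hea]
    obtain ⟨r, hr⟩ := he
    intro h0
    apply hG0
    rw [hr, map_mul, h0, zero_mul]

namespace MvPowerSeries

theorem maximalIdeal_eq_span_X (σ K : Type*) [Finite σ] [Field K] :
    IsLocalRing.maximalIdeal (MvPowerSeries σ K) = Ideal.span (Set.range X) := by
  ext f
  rw [IsLocalRing.mem_maximalIdeal, mem_nonunits_iff, isUnit_iff_constantCoeff, isUnit_iff_ne_zero,
    not_not]
  constructor
  · intro h
    have h1 := sub_truncTotal_mem_span_X_pow 1 f
    have h2 : truncTotal 1 f = 0 := by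
      ext e
      by_cases he : e.degree < 1
      · have he0 : e = 0 := (Finsupp.degree_eq_zero_iff e).1 (Nat.lt_one_iff.1 he)
        rw [coeff_truncTotal _ he, he0, coeff_zero_eq_constantCoeff_apply, h,
          MvPolynomial.coeff_zero]
      · rw [coeff_truncTotal_eq_zero _ (by omega), MvPolynomial.coeff_zero]
    rwa [pow_one, h2, MvPolynomial.coe_zero, sub_zero] at h1
  · intro h
    rw [← coeff_zero_eq_constantCoeff_apply]
    exact coeff_eq_zero_of_mem_span_X_pow (n := 1) (by rwa [pow_one]) (by simp)

instance (σ K : Type*) [Finite σ] [Field K] :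
    IsAdicComplete (IsLocalRing.maximalIdeal (MvPowerSeries σ K)) (MvPowerSeries σ K) := by
  rw [maximalIdeal_eq_span_X]
  infer_instance

theorem eval₂Hom_int_X_injective (σ K : Type*) [CommRing K] [CharZero K] :
    Function.Injective (MvPolynomial.eval₂Hom (Int.castRingHom (MvPowerSeries σ K)) X) := by
  have h : MvPolynomial.eval₂Hom (Int.castRingHom (MvPowerSeries σ K)) X =
      MvPolynomial.coeToMvPowerSeries.ringHom.comp (MvPolynomial.map (Int.castRingHom K)) :=
    MvPolynomial.ringHom_ext (fun r => by simp) fun i => by simp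
  rw [h, RingHom.coe_comp]
  exact Function.Injective.comp (g := MvPolynomial.coeToMvPowerSeries.ringHom)
    (MvPolynomial.coe_injective σ K)
    (MvPolynomial.map_injective _ (RingHom.injective_int _))

end MvPowerSeries

theorem algebraicIndependent_int_of_injective {σ Q : Type*} [CommRing Q] {x : σ → Q}
    (hx : Function.Injective (MvPolynomial.eval₂Hom (Int.castRingHom Q) x)) :
    AlgebraicIndependent ℤ x :=
  hx

theorem Polynomial.exists_map_subtype_eq {S : Type*} [CommRing S] (D : Subring S)
    {g : Polynomial S} (hg : ∀ a ∈ g.coeffs, a ∈ D) :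
    ∃ g' : Polynomial D, g'.map D.subtype = g := by
  refine ⟨g.toSubring D fun a ha => hg a ha, ?_⟩
  exact Polynomial.map_toSubring g D _

theorem exists_frobeniusModel_of_le {Q R : Type} [CommRing Q] [CommRing R] [IsDomain R] {d p : ℕ}
    {T T' : Set Q} {x : Fin d → Q} {y : Fin d → R} {β : Subring.closure T}
    (h : Subring.closure T ≤ Subring.closure T') (hp : p.Prime) (hpR : (p : R) = 0)
    (Φ : Subring.closure T' →+* R) (hy : FrobeniusRegular p y)
    (hΦ : ∀ (a : Subring.closure T') i, (a : Q) = x i → Φ a = y i) {γ : Subring.closure T'}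
    (hγ : Φ (⟨β, h β.2⟩ * γ) ≠ 0) :
    ∃ (p : ℕ) (R : Type) (_ : CommRing R) (_ : IsDomain R)
      (φ : Subring.closure T →+* R) (y : Fin d → R), p.Prime ∧ (p : R) = 0 ∧ FrobeniusRegular p y ∧
      (∀ (a : Subring.closure T) i, (a : Q) = x i → φ a = y i) ∧ φ β ≠ 0 := by
  obtain ⟨φ, hφ⟩ : ∃ φ : Subring.closure T →+* R, ∀ a, φ a = Φ ⟨a, h a.2⟩ :=
    ⟨Φ.comp (Subring.inclusion h), fun _ => rfl⟩
  refine ⟨p, R, _, ‹_›, φ, y, hp, hpR, hy, fun a i hai => (hφ a).trans (hΦ _ i hai),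
    fun h0 => hγ ?_⟩
  rw [map_mul, ← hφ, h0, zero_mul]

theorem HasFrobeniusModels.of_powerSeries {Q S : Type} [CommRing Q] [IsDomain Q] [CharZero Q]
    [CommRing S] [IsDomain S] [IsLocalRing S] [IsAdicComplete (IsLocalRing.maximalIdeal S) S]
    {d : ℕ} {x : Fin (d + 1) → Q} {z : Fin d → S} (hx : AlgebraicIndependent ℤ x)
    (hΘ : ∀ δ : Q, δ ≠ 0 → ∃ (c : Fin d → ℤ) (Θ : Q ≃+* PowerSeries S), Θ (x 0) = PowerSeries.X ∧
      (∀ i, Θ (x i.succ) = PowerSeries.C (z i) + (c i : PowerSeries S) * PowerSeries.X) ∧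
      ∃ n, IsUnit (PowerSeries.coeff n (Θ δ)))
    (hz : HasFrobeniusModels z) : HasFrobeniusModels x := by
  intro T hT β hβ
  set T₁ : Set (Q) := T ∪ Set.range x with hT₁
  have hT₁fin : T₁.Finite := hT.union (Set.finite_range _)
  have hXT₁ : ∀ i, x i ∈ T₁ := fun i => Or.inr ⟨i, rfl⟩
  have hβ0 : (β : Q) ≠ 0 := fun h => hβ (Subtype.ext h)
  have hβT : (β : Q) ∈ Subring.closure T₁ :=
    Subring.closure_mono Set.subset_union_left β.2
  obtain ⟨s, θ, f, G, hs, hXs, hf, hker, hfG, hG0, hTP, γ, e, hγ, he, heG⟩ :=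
    exists_presentation hx T₁ hT₁fin hXT₁
      hβ0 hβT
  set ev := evalPoly (fun i : s => (i : Q)) θ with hev
  obtain ⟨c, Θ, hΘ0, hΘs, hn⟩ := hΘ (ev G) hG0
  have hΘev : ∀ h, Θ (ev h) = evalPoly (fun i : s => Θ i) (Θ θ) h :=
    fun h => map_evalPoly Θ.toRingHom (fun i : s => (i : Q)) θ h
  obtain ⟨y₀, θ₀, w, U, q, hw, ⟨v, hv⟩, hG, hfq, hy₀, hdvd⟩ :=
    exists_polynomial_approximation (fun i : s => Θ i) (Θ θ) f G (by rw [← hΘev, hf, map_zero])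
      (by rwa [← hΘev])
  set T₂ := insert γ T₁ with hT₂
  have hT₂P : ∀ t ∈ T₂, ∃ P, ev P = ev G * t := by
    rintro t (rfl | ht)
    exacts [hγ, hTP t ht]
  choose! P hP using hT₂P
  have hT₂q : ∀ t ∈ T₂, ∃ r, evalPoly y₀ θ₀ (P t) = w * r := by
    intro t ht
    refine hdvd (P t) ⟨Θ t, ?_⟩
    rw [← hΘev, ← hΘev, hP t ht, map_mul]
  choose! r hr using hT₂q
  set Z : Set (Polynomial S) :=
    {w, U, q, θ₀} ∪ Set.range y₀ ∪ r '' T₂ with hZ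
  have : Finite s := hs
  have hZfin : Z.Finite := ((Set.toFinite _).union (Set.finite_range _)).union
    ((hT₁fin.insert γ).image r)
  set T' : Set S := (⋃ g ∈ Z, (g.coeffs : Set _)) ∪
    {(↑v⁻¹ : S)} ∪ Set.range z with hT'
  have hT'fin : T'.Finite := ((hZfin.biUnion fun g _ => Finset.finite_toSet _).union
    (Set.finite_singleton _)).union (Set.finite_range _)
  set D := Subring.closure T' with hD
  have hlift : ∀ g ∈ Z, ∃ g' : Polynomial D, g'.map D.subtype = g := fun g hg =>
    Polynomial.exists_map_subtype_eq D fun a ha =>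
      Subring.subset_closure (Or.inl (Or.inl (Set.mem_biUnion hg ha)))
  choose! l hl using hlift
  have hinj : Function.Injective (Polynomial.mapRingHom D.subtype) :=
    Polynomial.map_injective _ Subtype.val_injective
  obtain ⟨p, R, _, _, φ, x', hp, hpR, hx', hφx, -⟩ := hz T' hT'fin 1 one_ne_zero
  let ψ : Polynomial D →+* PowerSeries R :=
    Polynomial.coeToPowerSeries.ringHom.comp (Polynomial.mapRingHom φ)
  have hwZ : w ∈ Z := by simp [hZ]
  have hUZ : U ∈ Z := by simp [hZ]
  have hqZ : q ∈ Z := by simp [hZ]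
  have hθZ : θ₀ ∈ Z := by simp [hZ]
  have hyZ : ∀ i, y₀ i ∈ Z := by simp [hZ]
  have hrZ : ∀ t ∈ T₂, r t ∈ Z := fun t ht => Or.inr ⟨t, ht, rfl⟩
  have hlev : ∀ h, Polynomial.mapRingHom D.subtype (evalPoly (fun i => l (y₀ i)) (l θ₀) h) =
      evalPoly y₀ θ₀ h := by
    intro h
    rw [map_evalPoly]
    simp only [Polynomial.coe_mapRingHom, hl _ hθZ, hl _ (hyZ _)]
  have hψev : ∀ h, evalPoly (fun i => ψ (l (y₀ i))) (ψ (l θ₀)) h =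
      ψ (evalPoly (fun i => l (y₀ i)) (l θ₀) h) := fun h => (map_evalPoly ψ _ _ h).symm
  have hlG : evalPoly (fun i => l (y₀ i)) (l θ₀) G = l w * l U := by
    apply hinj
    rw [hlev, hG, map_mul, Polynomial.coe_mapRingHom, hl w hwZ, hl U hUZ]
  have hlf : evalPoly (fun i => l (y₀ i)) (l θ₀) f = l w ^ 2 * Polynomial.X * l q := by
    apply hinj
    rw [hlev, hfq, map_mul, map_mul, map_pow, Polynomial.coe_mapRingHom, hl w hwZ, hl q hqZ,
      Polynomial.map_X]
  have hlr : ∀ t ∈ T₂, evalPoly (fun i => l (y₀ i)) (l θ₀) (P t) = l w * l (r t) := by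
    intro t ht
    apply hinj
    rw [hlev, hr t ht, map_mul, Polynomial.coe_mapRingHom, hl w hwZ, hl _ (hrZ t ht)]
  have hψX : ψ Polynomial.X = PowerSeries.X := by simp [ψ]
  have hψw : ψ (l w) ≠ 0 := by
    have h1 : (l w).Monic := by
      refine Polynomial.monic_of_injective (f := D.subtype) Subtype.val_injective ?_
      rwa [hl w hwZ]
    exact fun h => (h1.map φ).ne_zero (Polynomial.coe_eq_zero_iff.1 h)
  have hψU : IsUnit (ψ (l U)) := by
    rw [PowerSeries.isUnit_iff_constantCoeff]
    have h1 : PowerSeries.constantCoeff (ψ (l U)) = φ ((l U).coeff 0) := by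
      change PowerSeries.constantCoeff (((l U).map φ : Polynomial R) : PowerSeries R) = _
      rw [Polynomial.constantCoeff_coe, Polynomial.coeff_map]
    have h2 : (l U).coeff 0 * ⟨(↑v⁻¹ : S),
        Subring.subset_closure (Or.inl (Or.inr rfl))⟩ = (1 : D) := by
      ext1
      have h3 := congrArg (fun g => Polynomial.coeff g 0) (hl U hUZ)
      simp only [Polynomial.coeff_map, Subring.subtype_apply] at h3
      change ((l U).coeff 0 : S) * ↑v⁻¹ = 1
      rw [h3, ← hv, Units.mul_inv]
    rw [h1]
    exact (IsUnit.of_mul_eq_one _ h2).map φ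
  obtain ⟨Φ, hΦ, hΦ0⟩ := exists_ringHom_of_approximate_root (T := T₂) hker hfG hψw hψU
    (by rw [hψev, hlG, map_mul]) (q := ψ (l q))
    (by rw [hψev, hlf, map_mul, map_mul, map_pow, hψX])
    (fun t ht => ⟨P t, hP t ht, ψ (l (r t)), by rw [hψev, hlr t ht, map_mul]⟩)
  have hle : Subring.closure T ≤ Subring.closure T₂ :=
    Subring.closure_mono (Set.subset_union_left.trans (Set.subset_insert _ _))
  have hpS : (p : PowerSeries R) = 0 := by
    rw [← map_natCast (PowerSeries.C : R →+* PowerSeries R), hpR, map_zero]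
  have hyx : ∀ i, ψ (l (y₀ ⟨x i, hXs i⟩)) = (Fin.cons PowerSeries.X fun i =>
      PowerSeries.C (x' i) + (c i : PowerSeries R) * PowerSeries.X :
        Fin (d + 1) → PowerSeries R) i := by
    intro i
    induction i using Fin.cases with
    | zero =>
      have h1 : y₀ ⟨x 0, hXs 0⟩ = Polynomial.X := hy₀ _ _ (by
        rw [hΘ0, Polynomial.coe_X])
      have h2 : l (y₀ ⟨x 0, hXs 0⟩) = Polynomial.X := by
        apply hinj
        rw [Polynomial.coe_mapRingHom, hl _ (hyZ _), h1, Polynomial.map_X]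
      rw [h2, hψX, Fin.cons_zero]
    | succ i =>
      have h1 : y₀ ⟨x i.succ, hXs i.succ⟩ =
          Polynomial.C (z i) + (c i : Polynomial _) * Polynomial.X := hy₀ _ _ (by
        rw [hΘs, Polynomial.coe_add, Polynomial.coe_mul, Polynomial.coe_C, Polynomial.coe_X,
          ← Polynomial.coeToPowerSeries.ringHom_apply (φ := (c i : Polynomial S)), map_intCast])
      have hb : z i ∈ D := Subring.subset_closure (Or.inr ⟨i, rfl⟩)
      have h2 : l (y₀ ⟨x i.succ, hXs i.succ⟩) =
          Polynomial.C ⟨z i, hb⟩ + (c i : Polynomial D) * Polynomial.X := by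
        apply hinj
        rw [Polynomial.coe_mapRingHom, hl _ (hyZ _), h1]
        simp
      have h3 : ψ (Polynomial.C ⟨z i, hb⟩) = PowerSeries.C (x' i) := by
        simp [ψ, hφx ⟨z i, hb⟩ i rfl]
      rw [h2, map_add, map_mul, map_intCast, hψX, h3, Fin.cons_succ]
  exact exists_frobeniusModel_of_le hle hp hpS Φ (hx'.powerSeries hp hpR c)
    (fun a i hai => (hΦ a ⟨x i, hXs i⟩ hai).trans (hyx i))
    (γ := ⟨γ, Subring.subset_closure (Set.mem_insert _ _)⟩) (hΦ0 _ e he heG)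

theorem MvPowerSeries.hasFrobeniusModels_X (K : Type) [Field K] [CharZero K] (d : ℕ) :
    HasFrobeniusModels (X : Fin d → MvPowerSeries (Fin d) K) := by
  induction d with
  | zero => exact .of_field_equiv (isEmptyEquiv (Fin 0) K).toRingEquiv _
  | succ d ih =>
    have : CharZero (MvPowerSeries (Fin (d + 1)) K) :=
      charZero_of_injective_ringHom (f := C (σ := Fin (d + 1)) (R := K)) C_injective
    have : IsDomain (MvPowerSeries (Fin (d + 1)) K) := NoZeroDivisors.to_isDomain _
    have : IsDomain (MvPowerSeries (Fin d) K) := NoZeroDivisors.to_isDomain _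
    refine .of_powerSeries (algebraicIndependent_int_of_injective
      (eval₂Hom_int_X_injective (Fin (d + 1)) K)) (fun δ hδ => ?_) ih
    obtain ⟨c, Θ, h0, hs, -, n, hn⟩ := exists_ringEquiv_powerSeries δ hδ
    exact ⟨c, Θ, h0, hs, n, by rwa [isUnit_iff_constantCoeff, isUnit_iff_ne_zero]⟩

theorem Module.Finite.exists_comp_eq_smul_of_injective {R M : Type*} [CommRing R] [IsDomain R]
    [AddCommGroup M] [Module R M] [Module.Finite R M] {m : M}
    (hm : Function.Injective fun r : R => r • m) :
    ∃ (c : R) (n : ℕ) (α : M →ₗ[R] (Fin n → R)) (ι : (Fin n → R) →ₗ[R] M), c ≠ 0 ∧ n ≠ 0 ∧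
      (∀ v, α (ι v) = c • v) ∧ ∀ a, ι (α a) = c • a := by
  classical
  obtain ⟨k, g, hg⟩ := Module.Finite.exists_fin (R := R) (M := M)
  obtain ⟨t, ht, htm⟩ := exists_maximal_linearIndepOn R g
  let b : Module.Basis t R (Submodule.span R (Set.range fun i : t => g i)) :=
    Module.Basis.span ht.linearIndependent
  have hmul : ∀ i, ∃ a : R, a ≠ 0 ∧ a • g i ∈ Submodule.span R (Set.range fun i : t => g i) := by
    intro i
    rw [← Set.image_eq_range g t]
    by_cases hi : i ∈ t
    · exact ⟨1, one_ne_zero, Submodule.smul_mem _ _ (Submodule.subset_span ⟨i, hi, rfl⟩)⟩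
    · exact htm i hi
  choose a ha0 ha using hmul
  set F := Submodule.span R (Set.range fun i : t => g i) with hF
  set c := ∏ i, a i with hc
  have hcM : ∀ x : M, c • x ∈ F := by
    intro x
    have hx : x ∈ Submodule.span R (Set.range g) := hg ▸ Submodule.mem_top
    induction hx using Submodule.span_induction with
    | mem x h =>
      obtain ⟨i, rfl⟩ := h
      rw [hc, ← Finset.prod_erase_mul _ _ (Finset.mem_univ i), mul_smul]
      exact F.smul_mem _ (ha i)
    | zero => simp
    | add x y _ _ hx hy => rw [smul_add]; exact F.add_mem hx hy
    | smul r x _ hx => rw [smul_comm]; exact F.smul_mem _ hx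
  have hc0 : c ≠ 0 := Finset.prod_ne_zero_iff.2 fun i _ => ha0 i
  let e : F ≃ₗ[R] (Fin (Fintype.card t) → R) := (b.reindex (Fintype.equivFin t)).equivFun
  refine ⟨c, Fintype.card t,
    e.toLinearMap ∘ₗ (LinearMap.lsmul R M c).codRestrict F hcM, F.subtype ∘ₗ e.symm.toLinearMap,
    hc0, fun h0 => ?_, fun v => ?_, fun x => ?_⟩
  · have : IsEmpty t := Fintype.card_eq_zero_iff.1 h0
    have h1 := hcM m
    rw [hF, Set.range_eq_empty, Submodule.span_empty, Submodule.mem_bot] at h1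
    exact hc0 (hm (by simpa using h1))
  · have : (LinearMap.lsmul R M c).codRestrict F hcM (e.symm v : F) = c • e.symm v := rfl
    simp [this]
  · have : ((LinearMap.lsmul R M c).codRestrict F hcM x : M) = c • x := rfl
    simp [this]

open scoped TensorProduct in
theorem KoszulDatum.le_of_ringHom {R₀ A R : Type} [CommRing R₀] [CommRing A] [Algebra R₀ A]
    [CommRing R] [IsDomain R] {p d s n : ℕ} (hp : p.Prime) (hpR : (p : R) = 0) {x : Fin d → R₀}
    (φ : R₀ →+* R) (hx : FrobeniusRegular p fun j => φ (x j))
    (K : KoszulDatum A d s fun j => algebraMap R₀ A (x j)) {c : R₀} (hc : φ c ≠ 0) (hn : n ≠ 0)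
    (α : A →ₗ[R₀] (Fin n → R₀)) (ι : (Fin n → R₀) →ₗ[R₀] A)
    (hαι : ∀ v, α (ι v) = c • v) (hια : ∀ a, ι (α a) = c • a) : d ≤ s := by
  classical
  algebraize [φ]
  have : NeZero n := ⟨hn⟩
  let e := TensorProduct.piScalarRight R₀ R R (Fin n)
  have hαι' : α ∘ₗ ι = c • LinearMap.id := LinearMap.ext hαι
  have hια' : ι ∘ₗ α = c • LinearMap.id := LinearMap.ext hια
  have K' := K.map (Algebra.TensorProduct.includeRight (R := R₀) (A := R) (B := A)).toRingHom
  have hK : (fun j => (Algebra.TensorProduct.includeRight (R := R₀) (A := R) (B := A)).toRingHom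
      (algebraMap R₀ A (x j))) = fun j => algebraMap R (R ⊗[R₀] A) (φ (x j)) := by
    funext j
    change Algebra.TensorProduct.includeRight (algebraMap R₀ A (x j)) = _
    rw [AlgHom.commutes, IsScalarTower.algebraMap_apply R₀ R (R ⊗[R₀] A)]
    rfl
  rw [hK] at K'
  refine KoszulDatum.le_of_frobeniusRegular hp hpR hx K' hc
    (e.toLinearMap ∘ₗ α.baseChange R) (ι.baseChange R ∘ₗ e.symm.toLinearMap)
    (fun v => ?_) (fun a => ?_)
  · have h := congrArg (fun f => f.baseChange R (e.symm v)) hαι'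
    simp only [LinearMap.baseChange_comp, LinearMap.baseChange_smul, LinearMap.baseChange_id,
      LinearMap.comp_apply, LinearMap.smul_apply, LinearMap.id_apply] at h
    simp only [LinearMap.comp_apply, LinearEquiv.coe_coe, h]
    rw [← algebraMap_smul R c (e.symm v), map_smul, e.apply_symm_apply]
    rfl
  · have h := congrArg (fun f => f.baseChange R a) hια'
    simp only [LinearMap.baseChange_comp, LinearMap.baseChange_smul, LinearMap.baseChange_id,
      LinearMap.comp_apply, LinearMap.smul_apply, LinearMap.id_apply] at h
    simp only [LinearMap.comp_apply, LinearEquiv.coe_coe, e.symm_apply_apply, h]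
    rw [← algebraMap_smul R c a]
    rfl

theorem KoszulDatum.le_of_hasFrobeniusModels {R S : Type} [CommRing R] [IsDomain R] [CommRing S]
    [Algebra R S] [Module.Finite R S] (hinj : Function.Injective (algebraMap R S)) {d s : ℕ}
    {x : Fin d → R} (hx : HasFrobeniusModels x)
    (K : KoszulDatum S d s fun j => algebraMap R S (x j)) : d ≤ s := by
  classical
  obtain ⟨c, n, α, ι, hc, hn, hαι, hια⟩ :=
    Module.Finite.exists_comp_eq_smul_of_injective (R := R) (m := (1 : S))
      (by simpa only [← Algebra.algebraMap_eq_smul_one] using hinj)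
  obtain ⟨F, hF, hdesc⟩ := K.exists_descent
  obtain ⟨k, g, hg⟩ := Module.Finite.exists_fin (R := R) (M := S)
  have hrep : ∀ a : S, ∃ f : Fin k → R, ∑ l, f l • g l = a := fun a =>
    (Submodule.mem_span_range_iff_exists_fun R).1 (hg ▸ Submodule.mem_top)
  choose f hf using hrep
  set G : Set S := F ∪ {1} ∪ (Set.range fun i : Fin k × Fin k => g i.1 * g i.2) ∪
    Set.range (fun i => ι (Pi.single i 1)) with hG
  have hGfin : G.Finite := ((hF.union (Set.finite_singleton _)).union (Set.finite_range _)).union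
    (Set.finite_range _)
  set T : Set R := {c} ∪ Set.range x ∪ (⋃ a ∈ G, Set.range (f a)) ∪
    Set.range (fun i : Fin k × Fin n => α (g i.1) i.2) with hT
  have hTfin : T.Finite := ((((Set.finite_singleton _).union (Set.finite_range _)).union
    (hGfin.biUnion fun a _ => Set.finite_range _))).union (Set.finite_range _)
  set R₀ := Subring.closure T with hR₀
  have hcR : c ∈ R₀ := Subring.subset_closure (by simp [hT])
  have hxR : ∀ j, x j ∈ R₀ := fun j => Subring.subset_closure (by simp [hT])
  have hfR : ∀ a ∈ G, ∀ l, f a l ∈ R₀ := fun a ha l =>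
    Subring.subset_closure (Or.inl (Or.inr (Set.mem_biUnion ha ⟨l, rfl⟩)))
  have hαR : ∀ l i, α (g l) i ∈ R₀ := fun l i => Subring.subset_closure (Or.inr ⟨(l, i), rfl⟩)
  obtain ⟨p, R', _, _, φ, y, hp, hpR, hy, hφ, hφc⟩ :=
    hx T hTfin ⟨c, hcR⟩ (fun h => hc (congrArg Subtype.val h))
  set P : Submodule R₀ S := Submodule.span R₀ (Set.range g) with hP
  have hGP : ∀ a ∈ G, a ∈ P := by
    intro a ha
    rw [← hf a]
    refine P.sum_mem fun l _ => ?_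
    exact P.smul_mem (⟨f a l, hfR a ha l⟩ : R₀) (Submodule.subset_span ⟨l, rfl⟩)
  let A₀ : Subalgebra R₀ S := P.toSubalgebra (hGP 1 (by simp [hG])) (by
    intro a b ha hb
    induction ha, hb using Submodule.span_induction₂ with
    | mem_mem a b ha hb =>
      obtain ⟨i, rfl⟩ := ha
      obtain ⟨j, rfl⟩ := hb
      exact hGP _ (Or.inl (Or.inr ⟨(i, j), rfl⟩))
    | zero_left => simp
    | zero_right => simp
    | add_left a b c _ _ _ h h' => rw [add_mul]; exact P.add_mem h h'
    | add_right a b c _ _ _ h h' => rw [mul_add]; exact P.add_mem h h'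
    | smul_left r a b _ _ h => rw [smul_mul_assoc]; exact P.smul_mem _ h
    | smul_right r a b _ _ h => rw [mul_smul_comm]; exact P.smul_mem _ h)
  have hαP : ∀ a ∈ P, ∀ i, α a i ∈ R₀ := by
    intro a ha i
    induction ha using Submodule.span_induction with
    | mem a ha =>
      obtain ⟨l, rfl⟩ := ha
      exact hαR l i
    | zero => simp
    | add a b _ _ h h' => rw [map_add]; exact R₀.add_mem h h'
    | smul r a _ h =>
      have : α (r • a) = (r : R) • α a := α.map_smul (r : R) a
      rw [this]
      exact R₀.mul_mem r.2 h
  have hιP : ∀ v : Fin n → R₀, ι (fun i => v i) ∈ P := by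
    intro v
    have : (fun i => (v i : R)) = ∑ i, (v i : R) • Pi.single i (1 : R) := by
      simpa using pi_eq_sum_univ' (fun i => (v i : R))
    rw [this, map_sum]
    refine P.sum_mem fun i _ => ?_
    rw [map_smul]
    exact P.smul_mem (v i) (hGP _ (Or.inr ⟨i, rfl⟩))
  let α₀ : A₀ →ₗ[R₀] (Fin n → R₀) :=
    { toFun a i := ⟨α a i, hαP a a.2 i⟩
      map_add' a b := by
        ext i
        exact congrFun (α.map_add (a : S) b) i
      map_smul' r a := by
        ext i
        exact congrFun (α.map_smul (r : R) (a : S)) i }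
  let ι₀ : (Fin n → R₀) →ₗ[R₀] A₀ :=
    { toFun v := ⟨ι fun i => v i, hιP v⟩
      map_add' v w := by
        ext
        exact ι.map_add (fun i => (v i : R)) fun i => (w i : R)
      map_smul' r v := by
        ext
        exact ι.map_smul (r : R) fun i => (v i : R) }
  obtain ⟨K₀⟩ := hdesc A₀.toSubring (fun a ha => hGP a (Or.inl (Or.inl (Or.inl ha))))
    (fun j => algebraMap R₀ A₀ ⟨x j, hxR j⟩) (fun j => rfl)
  have hφx : (fun j => φ ⟨x j, hxR j⟩) = y := funext fun j => hφ _ j rfl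
  exact KoszulDatum.le_of_ringHom (A := A₀) hp hpR φ (by rwa [hφx]) K₀ hφc hn α₀ ι₀
    (fun v => funext fun i => Subtype.ext (congrFun (hαι fun i => v i) i))
    (fun a => Subtype.ext (hια a))

theorem Algebra.FormallySmooth.of_charZero (K L : Type*) [Field K] [Field L] [Algebra K L]
    [CharZero K] : Algebra.FormallySmooth K L := by
  obtain ⟨s, hs⟩ := exists_isTranscendenceBasis K L
  have := hs.isAlgebraic_field
  exact .of_algebraicIndependent_of_isSeparable hs.1

theorem IsLocalRing.exists_section_residue (S : Type*) [CommRing S] [IsLocalRing S]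
    [IsAdicComplete (maximalIdeal S) S] [Algebra ℚ S] :
    ∃ σ : ResidueField S →+* S, ∀ a, residue S (σ a) = a := by
  have := Algebra.FormallySmooth.of_charZero ℚ (ResidueField S)
  obtain ⟨g, hg⟩ := Algebra.FormallySmooth.exists_mkₐ_comp_eq_of_isAdicComplete (R := ℚ)
    (A := ResidueField S) (I := maximalIdeal S) (AlgHom.id ℚ (ResidueField S))
  exact ⟨g.toRingHom, fun a => DFunLike.congr_fun hg a⟩

theorem MvPowerSeries.exists_algHom_of_isAdicComplete {σ k S : Type*} [Finite σ] [CommRing k]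
    [CommRing S] [Algebra k S] (I : Ideal S) [IsAdicComplete I S] {x : σ → S} (hx : ∀ i, x i ∈ I) :
    ∃ Φ : MvPowerSeries σ k →ₐ[k] S, ∀ i, Φ (X i) = x i := by
  have hle : ∀ n, MvPolynomial.idealOfVars σ k ^ n ≤ (I ^ n).comap (MvPolynomial.aeval x) := by
    intro n
    rw [← Ideal.map_le_iff_le_comap, Ideal.map_pow]
    refine Ideal.pow_right_mono ?_ n
    rw [MvPolynomial.idealOfVars, Ideal.map_span, Ideal.span_le]
    rintro _ ⟨_, ⟨i, rfl⟩, rfl⟩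
    simpa using hx i
  obtain ⟨f, hf⟩ : ∃ f : ∀ n, MvPowerSeries σ k →ₐ[k] S ⧸ I ^ n, ∀ n p q,
      truncTotalAlgHom σ k n p = Ideal.Quotient.mk _ q →
        f n p = Ideal.Quotient.mk _ (MvPolynomial.aeval x q) := by
    refine ⟨fun n => (Ideal.quotientMapₐ (I ^ n) (MvPolynomial.aeval x) (hle n)).comp
      ((truncTotalAlgHom σ k n).restrictScalars k), fun n p q h => ?_⟩
    rw [AlgHom.comp_apply, AlgHom.restrictScalars_apply, h, Ideal.quotient_map_mkₐ,
      Ideal.Quotient.mkₐ_eq_mk]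
  have hcomp : ∀ {m n : ℕ} (h : m ≤ n),
      (Ideal.Quotient.factorₐ k (Ideal.pow_le_pow_right h)).comp (f n) = f m := by
    intro m n h
    ext p
    rw [AlgHom.comp_apply, hf n p _ (truncTotalAlgHom_apply ..),
      hf m p _ (truncTotalAlgHom_apply ..), Ideal.Quotient.factorₐ_apply_mk, Ideal.Quotient.eq,
      ← map_sub]
    exact hle m (truncTotal_sub_truncTotal_mem_pow_idealOfVars h le_rfl p)
  refine ⟨IsAdicComplete.liftAlgHom I f hcomp, congrFun (IsHausdorff.funext' I fun n i => ?_)⟩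
  rw [IsAdicComplete.mk_liftAlgHom, hf n (X i) (MvPolynomial.X i), MvPolynomial.aeval_X]
  rw [← MvPolynomial.coe_X]
  exact (truncTotalAlgHom σ k n).commutes (MvPolynomial.X i)

theorem Ideal.mem_smul_top_pi_iff {P ι : Type*} [CommRing P] [Finite ι] {I : Ideal P} {v : ι → P} :
    v ∈ I • (⊤ : Submodule P (ι → P)) ↔ ∀ i, v i ∈ I := by
  classical
  have := Fintype.ofFinite ι
  constructor
  · intro h i
    refine Submodule.smul_induction_on h (fun r hr w _ => ?_) fun v w hv hw => ?_
    · exact I.mul_mem_right _ hr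
    · exact I.add_mem hv hw
  · intro h
    rw [pi_eq_sum_univ' v]
    exact Submodule.sum_mem _ fun i _ => Submodule.smul_mem_smul (h i) trivial

instance IsPrecomplete.pi {P ι : Type*} [CommRing P] [Finite ι] (I : Ideal P) [IsPrecomplete I P] :
    IsPrecomplete I (ι → P) where
  prec' f hf := by
    simp only [SModEq.sub_mem, Ideal.mem_smul_top_pi_iff] at hf ⊢
    have h : ∀ i, ∃ L : P, ∀ n, f n i - L ∈ I ^ n := by
      intro i
      obtain ⟨L, hL⟩ := IsPrecomplete.prec (I := I) (M := P) inferInstance (f := fun n => f n i)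
        (fun {m n} hmn => by
          rw [SModEq.sub_mem, smul_eq_mul, Ideal.mul_top]
          exact hf hmn i)
      refine ⟨L, fun n => ?_⟩
      have := hL n
      rwa [SModEq.sub_mem, smul_eq_mul, Ideal.mul_top] at this
    choose L hL using h
    exact ⟨L, fun n i => hL i n⟩

theorem IsLocalRing.exists_fg_sub_mem_maximalIdeal_pow {k S : Type*} [Field k] [CommRing S]
    [IsLocalRing S] [Algebra k S] (hm : (maximalIdeal S).FG)
    (hres : ∀ a : S, ∃ b : k, a - algebraMap k S b ∈ maximalIdeal S) (n : ℕ) :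
    ∃ V : Submodule k S, V.FG ∧ ∀ a, ∃ v ∈ V, a - v ∈ maximalIdeal S ^ n := by
  induction n with
  | zero => exact ⟨⊥, Submodule.fg_bot, fun a => ⟨0, by simp, by simp⟩⟩
  | succ n ih =>
    obtain ⟨V, hV, hVa⟩ := ih
    obtain ⟨B, hB⟩ := hm.pow (n := n)
    refine ⟨V ⊔ Submodule.span k (B : Set S), hV.sup (Submodule.fg_span B.finite_toSet),
      fun a => ?_⟩
    obtain ⟨v, hv, hav⟩ := hVa a
    suffices H : ∀ b ∈ maximalIdeal S ^ n, ∃ w ∈ Submodule.span k (B : Set S),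
        b - w ∈ maximalIdeal S ^ (n + 1) by
      obtain ⟨w, hw, hbw⟩ := H _ hav
      exact ⟨v + w, Submodule.add_mem_sup hv hw, by rwa [← sub_sub]⟩
    intro b hb
    rw [← hB] at hb
    have hBm : ∀ b ∈ Submodule.span S (B : Set S), b ∈ maximalIdeal S ^ n := fun b hb => hB ▸ hb
    induction hb using Submodule.span_induction with
    | mem b hb => exact ⟨b, Submodule.subset_span hb, by simp⟩
    | zero => exact ⟨0, zero_mem _, by simp⟩
    | add b c _ _ hb hc =>
      obtain ⟨w, hw, h⟩ := hb
      obtain ⟨w', hw', h'⟩ := hc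
      exact ⟨w + w', add_mem hw hw', by rw [add_sub_add_comm]; exact add_mem h h'⟩
    | smul r b hb ih =>
      obtain ⟨w, hw, h⟩ := ih
      obtain ⟨c, hc⟩ := hres r
      refine ⟨c • w, Submodule.smul_mem _ _ hw, ?_⟩
      have : r • b - c • w = (r - algebraMap k S c) * b + algebraMap k S c * (b - w) := by
        rw [smul_eq_mul, Algebra.smul_def]
        ring
      rw [this, pow_succ']
      exact add_mem (Ideal.mul_mem_mul hc (hBm b hb))
        (Ideal.mul_mem_left _ _ (pow_succ' (maximalIdeal S) n ▸ h))

theorem Module.Finite.of_isAdicComplete {k P S : Type*} [Field k] [CommRing P] [CommRing S]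
    [IsLocalRing S] [Algebra k S] [Algebra k P] [Algebra P S] [IsScalarTower k P S]
    (hm : (IsLocalRing.maximalIdeal S).FG) [IsHausdorff (IsLocalRing.maximalIdeal S) S]
    (hres : ∀ a : S, ∃ b : k, a - algebraMap k S b ∈ IsLocalRing.maximalIdeal S)
    (I : Ideal P) [IsPrecomplete I P]
    (hI : I.map (algebraMap P S) ≤ IsLocalRing.maximalIdeal S) {N : ℕ}
    (hN : IsLocalRing.maximalIdeal S ^ N ≤ I.map (algebraMap P S)) : Module.Finite P S := by
  obtain ⟨V, ⟨B, hB⟩, hVa⟩ := IsLocalRing.exists_fg_sub_mem_maximalIdeal_pow hm hres N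
  have : IsHausdorff I S := IsHausdorff.of_map hI
  let f : (B → P) →ₗ[P] S := Fintype.linearCombination P (fun b : B => (b : S))
  refine Module.Finite.of_surjective f (surjective_of_mkQ_comp_surjective (I := I) fun a => ?_)
  obtain ⟨a, rfl⟩ := Submodule.mkQ_surjective _ a
  obtain ⟨v, hv, hav⟩ := hVa a
  have hvf : v ∈ LinearMap.range f := by
    rw [Fintype.range_linearCombination, Subtype.range_coe_subtype]
    rw [← hB] at hv
    exact Submodule.span_subset_span k P _ hv
  obtain ⟨w, rfl⟩ := hvf
  refine ⟨w, ?_⟩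
  rw [LinearMap.comp_apply, ← sub_eq_zero, ← map_sub, Submodule.mkQ_apply,
    Submodule.Quotient.mk_eq_zero, Ideal.smul_top_eq_map, Submodule.restrictScalars_mem,
    ← neg_mem_iff, neg_sub]
  exact hN hav

theorem PowerSeries.X_pow_mem_span_sup_map_C {R : Type*} [CommRing R] [IsLocalRing R]
    {g : PowerSeries R} (hg : ∃ n, IsUnit (coeff n g)) :
    ∃ n, (X : PowerSeries R) ^ n ∈ Ideal.span {g} ⊔ (IsLocalRing.maximalIdeal R).map C := by
  classical
  have hn := Nat.find_spec hg
  have hlt : ∀ m < Nat.find hg, coeff m g ∈ IsLocalRing.maximalIdeal R :=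
    fun m hm => (IsLocalRing.mem_maximalIdeal _).2 (Nat.find_min hg hm)
  set n := Nat.find hg
  refine ⟨n, ?_⟩
  obtain ⟨a, ha, b, hb, hab⟩ := Submodule.mem_sup.1 (mem_span_X_pow_sup_map_C.2 hlt)
  obtain ⟨u, rfl⟩ := Ideal.mem_span_singleton.1 ha
  have hu : IsUnit u := by
    rw [isUnit_iff_constantCoeff]
    have h1 : coeff n g = constantCoeff u + coeff n b := by
      rw [← hab, map_add, coeff_X_pow_mul', if_pos le_rfl, Nat.sub_self,
        coeff_zero_eq_constantCoeff_apply]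
    by_contra h2
    exact (IsLocalRing.mem_maximalIdeal _).1 (h1 ▸ add_mem ((IsLocalRing.mem_maximalIdeal _).2 h2)
      (coeff_mem_of_mem_map_C hb n)) hn
  obtain ⟨v, hv⟩ := hu.exists_right_inv
  have h3 : (X : PowerSeries R) ^ n = g * v - b * v := by
    linear_combination -(X : PowerSeries R) ^ n * hv - v * hab + 2 * v * hab
  rw [h3]
  exact sub_mem (Ideal.mem_sup_left (Ideal.mul_mem_right _ _ (Ideal.mem_span_singleton_self g)))
    (Ideal.mem_sup_right (Ideal.mul_mem_right _ _ hb))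

theorem MvPowerSeries.injective_of_X_pow_notMem {K S : Type*} [Field K] [CharZero K] [CommRing S]
    {d : ℕ} (Φ : MvPowerSeries (Fin (d + 1)) K →+* S)
    (h : ∀ (c : Fin d → ℤ) (n : ℕ), Φ (X 0) ^ n ∉
      Ideal.span (Set.range fun i : Fin d => Φ (X i.succ) - (c i : S) * Φ (X 0))) :
    Function.Injective Φ := by
  rw [injective_iff_map_eq_zero]
  by_contra! ⟨r, hr, hr0⟩
  obtain ⟨c, Θ, h0, hs, -, n, hn⟩ := exists_ringEquiv_powerSeries r hr0
  obtain ⟨m, hm⟩ := PowerSeries.X_pow_mem_span_sup_map_C (g := Θ r)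
    ⟨n, by rwa [isUnit_iff_constantCoeff, isUnit_iff_ne_zero]⟩
  refine h c m ?_
  have h1 := Ideal.mem_map_of_mem (Φ.comp Θ.symm.toRingHom) hm
  have h2 : ∀ i, Φ (Θ.symm (PowerSeries.C (X i))) = Φ (X i.succ) - (c i : S) * Φ (X 0) := by
    intro i
    have h3 : PowerSeries.C (X i) = Θ (X i.succ - (c i : MvPowerSeries (Fin (d + 1)) K) * X 0) := by
      rw [map_sub, map_mul, map_intCast, h0, hs, add_sub_cancel_right]
    rw [h3, Θ.symm_apply_apply, map_sub, map_mul, map_intCast]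
  rw [Ideal.map_sup, Ideal.map_span, Set.image_singleton, maximalIdeal_eq_span_X, Ideal.map_span,
    Ideal.map_span, ← Set.range_comp, ← Set.range_comp] at h1
  have h4 : (Φ.comp Θ.symm.toRingHom) (Θ r) = 0 := by
    change Φ (Θ.symm (Θ r)) = 0
    rw [Θ.symm_apply_apply, hr]
  have h5 : (Φ.comp Θ.symm.toRingHom) (PowerSeries.X ^ m) = Φ (X 0) ^ m := by
    change Φ (Θ.symm (PowerSeries.X ^ m)) = _
    rw [← h0, ← map_pow, Θ.symm_apply_apply, map_pow]
  rw [h4, h5, Ideal.span_singleton_eq_bot.2 rfl, bot_sup_eq] at h1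
  convert h1 using 4 with i
  exact (h2 i).symm

theorem AdicCompletion.mem_of_algebraMap_mem_map {A : Type*} [CommRing A] [IsLocalRing A]
    [IsNoetherianRing A] {J : Ideal A} {a : A}
    (h : algebraMap A (AdicCompletion (IsLocalRing.maximalIdeal A) A) a ∈
      J.map (algebraMap A (AdicCompletion (IsLocalRing.maximalIdeal A) A))) : a ∈ J := by
  set m := IsLocalRing.maximalIdeal A with hm
  have h1 : ∀ n, a ∈ J ⊔ m ^ n := by
    intro n
    have h2 := Ideal.mem_map_of_mem (evalₐ m n).toRingHom h
    have h3 : (evalₐ m n).toRingHom.comp (algebraMap A (AdicCompletion m A)) =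
        Ideal.Quotient.mk (m ^ n) := (evalₐ m n).comp_algebraMap
    rw [Ideal.map_map, h3, ← RingHom.comp_apply, h3, ← Ideal.mem_comap,
      Ideal.comap_map_of_surjective' _ Ideal.Quotient.mk_surjective, Ideal.mk_ker] at h2
    exact h2
  rw [← Ideal.Quotient.eq_zero_iff_mem]
  refine IsHausdorff.haus (I := m) (M := A ⧸ J) inferInstance _ fun n => ?_
  obtain ⟨b, hb, c, hc, rfl⟩ := Submodule.mem_sup.1 (h1 n)
  rw [SModEq.zero, map_add, Ideal.Quotient.eq_zero_iff_mem.2 hb, zero_add,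
    ← Ideal.Quotient.algebraMap_eq, Algebra.algebraMap_eq_smul_one]
  exact Submodule.smul_mem_smul hc trivial

theorem IsLocalRing.ringKrullDim_le_of_maximalIdeal_le_radical {A : Type*} [CommRing A]
    [IsLocalRing A] [IsNoetherianRing A] {d : ℕ} {y : Fin d → A} (hy : ∀ i, y i ∈ maximalIdeal A)
    (h : maximalIdeal A ≤ (Ideal.span (Set.range y)).radical) : ringKrullDim A ≤ d := by
  have hmin : maximalIdeal A ∈ (Ideal.span (Set.range y)).minimalPrimes := by
    refine ⟨⟨inferInstance, Ideal.span_le.2 (Set.range_subset_iff.2 hy)⟩, fun q hq _ => ?_⟩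
    exact h.trans (hq.1.radical_le_iff.2 hq.2)
  have h1 := Ideal.height_le_card_of_mem_minimalPrimes_span (Set.finite_range y) hmin
  rw [← maximalIdeal_height_eq_ringKrullDim]
  have h2 : (Set.range y).ncard ≤ d := by
    rw [← Set.image_univ]
    exact (Set.ncard_image_le Set.finite_univ).trans (by simp [Set.ncard_univ])
  exact_mod_cast h1.trans (by exact_mod_cast h2)

theorem KoszulDatum.le_of_isNoetherianRing {A : Type} [CommRing A] [IsLocalRing A]
    [IsNoetherianRing A] [Algebra ℚ A] {d s N : ℕ} (hdim : ringKrullDim A = d) {x : Fin d → A}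
    (hx : ∀ i, x i ∈ IsLocalRing.maximalIdeal A)
    (hN : IsLocalRing.maximalIdeal A ^ N ≤ Ideal.span (Set.range x)) (K : KoszulDatum A d s x) :
    d ≤ s := by
  cases d with
  | zero => exact Nat.zero_le _
  | succ d =>
  let S := AdicCompletion (IsLocalRing.maximalIdeal A) A
  let f := algebraMap A S
  have hmS : IsLocalRing.maximalIdeal S = (IsLocalRing.maximalIdeal A).map f :=
    AdicCompletion.maximalIdeal_eq_map
  obtain ⟨σ, hσ⟩ := IsLocalRing.exists_section_residue S
  let k := IsLocalRing.ResidueField S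
  let : Algebra k S := σ.toAlgebra
  have hfx : ∀ i, f (x i) ∈ IsLocalRing.maximalIdeal S := fun i =>
    hmS ▸ Ideal.mem_map_of_mem f (hx i)
  obtain ⟨Φ, hΦ⟩ := MvPowerSeries.exists_algHom_of_isAdicComplete (k := k)
    (IsLocalRing.maximalIdeal S) hfx
  let : Algebra (MvPowerSeries (Fin (d + 1)) k) S := Φ.toRingHom.toAlgebra
  have : IsScalarTower k (MvPowerSeries (Fin (d + 1)) k) S :=
    IsScalarTower.of_algebraMap_eq fun a => (Φ.commutes a).symm
  have : CharZero k := algebraRat.charZero k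
  have hmap : (IsLocalRing.maximalIdeal (MvPowerSeries (Fin (d + 1)) k)).map
      (algebraMap (MvPowerSeries (Fin (d + 1)) k) S) = (Ideal.span (Set.range x)).map f := by
    rw [MvPowerSeries.maximalIdeal_eq_span_X, Ideal.map_span, Ideal.map_span, ← Set.range_comp,
      ← Set.range_comp]
    congr 2
    exact funext hΦ
  have hfin : Module.Finite (MvPowerSeries (Fin (d + 1)) k) S := by
    refine Module.Finite.of_isAdicComplete (k := k) (N := N) ?_
      (fun a => ⟨IsLocalRing.residue S a, ?_⟩)
      (IsLocalRing.maximalIdeal (MvPowerSeries (Fin (d + 1)) k)) ?_ ?_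
    · rw [hmS]
      exact Ideal.FG.map (IsNoetherian.noetherian (IsLocalRing.maximalIdeal A)) f
    · rw [← IsLocalRing.residue_eq_zero_iff, map_sub, sub_eq_zero]
      exact (hσ _).symm
    · rw [hmap, hmS]
      exact Ideal.map_mono (Ideal.span_le.2 (Set.range_subset_iff.2 hx))
    · rw [hmap, hmS, ← Ideal.map_pow]
      exact Ideal.map_mono hN
  have hinj : Function.Injective (algebraMap (MvPowerSeries (Fin (d + 1)) k) S) := by
    refine MvPowerSeries.injective_of_X_pow_notMem _ fun c n hn => ?_
    let y : Fin d → A := fun i => x i.succ - (c i : A) * x 0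
    have h1 : x 0 ^ n ∈ Ideal.span (Set.range y) := by
      refine AdicCompletion.mem_of_algebraMap_mem_map ?_
      rw [Ideal.map_span, ← Set.range_comp, map_pow]
      have hy : (f ∘ y) = fun i =>
          Φ (MvPowerSeries.X i.succ) - c i * Φ (MvPowerSeries.X 0) := by
        funext i
        change f (x i.succ - (c i : A) * x 0) = _
        rw [hΦ, hΦ, map_sub, map_mul, map_intCast]
      change f (x 0) ^ n ∈ Ideal.span (Set.range (f ∘ y))
      rw [hy, ← hΦ 0]
      exact hn
    have h2 : ∀ i, x i ∈ (Ideal.span (Set.range y)).radical := by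
      intro i
      have h0 : x 0 ∈ (Ideal.span (Set.range y)).radical := ⟨n, h1⟩
      induction i using Fin.cases with
      | zero => exact h0
      | succ i =>
        have : x i.succ = y i + c i * x 0 := by simp [y]
        rw [this]
        exact add_mem (Ideal.le_radical (Ideal.subset_span ⟨i, rfl⟩)) (Ideal.mul_mem_left _ _ h0)
    have h3 := IsLocalRing.ringKrullDim_le_of_maximalIdeal_le_radical (y := y)
      (fun i => sub_mem (hx _) (Ideal.mul_mem_left _ _ (hx 0))) (fun a ha => by
        rw [← Ideal.radical_idem]
        exact ⟨N, Ideal.span_le.2 (Set.range_subset_iff.2 h2) (hN (Ideal.pow_mem_pow ha N))⟩)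
    rw [hdim] at h3
    have : d + 1 ≤ d := by exact_mod_cast h3
    lia
  have hK : (fun j => algebraMap (MvPowerSeries (Fin (d + 1)) k) S (MvPowerSeries.X j)) =
      fun j => f (x j) := funext hΦ
  have : IsDomain (MvPowerSeries (Fin (d + 1)) k) := NoZeroDivisors.to_isDomain _
  exact KoszulDatum.le_of_hasFrobeniusModels hinj (MvPowerSeries.hasFrobeniusModels_X k (d + 1))
    (hK ▸ K.map f)

/-- If a matrix has all its columns annihilated by `D` and `y` multiplies the kernel of `D` into
the image of `E`, then `y` times that matrix factors through `E`. -/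
theorem Matrix.exists_mul_eq_smul {A l m n o : Type*} [CommRing A] [Fintype l] [Fintype m]
    [Fintype n] [Fintype o] {D : Matrix l m A} {E : Matrix m n A} {y : A}
    (h : ∀ v, D.mulVec v = 0 → ∃ w, E.mulVec w = y • v) {G : Matrix m o A} (hG : D * G = 0) :
    ∃ F : Matrix n o A, E * F = y • G := by
  have h' : ∀ j, ∃ w, E.mulVec w = y • G.col j := fun j => h _ <| by
    ext i
    exact congrFun (congrFun hG i) j
  choose w hw using h'
  refine ⟨Matrix.of fun i j => w j i, ?_⟩
  ext i j
  exact congrFun (hw j) i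

theorem Matrix.mul_smul_one_sub_mul_eq_zero {A : Type*} [CommRing A] {n : ℕ → ℕ} (hn : n 0 = 0)
    {D : ∀ i, Matrix (Fin (n i)) (Fin (n (i + 1))) A} (hD : ∀ i, D i * D (i + 1) = 0) {c : A}
    {k : ℕ} {H : ∀ i, Matrix (Fin (n (i + 1))) (Fin (n i)) A}
    (hH : ∀ i < k, D (i + 1) * H (i + 1) + H i * D i = c • (1 : Matrix _ _ A)) :
    D k * (c • (1 : Matrix _ _ A) - H k * D k) = 0 := by
  rcases k with _ | k
  · ext i
    exact (hn ▸ i).elim0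
  · rw [Matrix.mul_sub, ← Matrix.mul_assoc, eq_sub_of_add_eq (hH k (by lia)), Matrix.sub_mul,
      Matrix.mul_assoc, hD]
    simp

/-- An element annihilating the homology of a bounded complex of free modules has a power that
is null-homotopic. -/
theorem Matrix.exists_homotopy_pow {A : Type*} [CommRing A] {n : ℕ → ℕ} (hn : n 0 = 0)
    {D : ∀ i, Matrix (Fin (n i)) (Fin (n (i + 1))) A} (hD : ∀ i, D i * D (i + 1) = 0) {y : A}
    (k : ℕ) (h : ∀ i < k, ∀ v, (D i).mulVec v = 0 → ∃ w, (D (i + 1)).mulVec w = y • v) :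
    ∃ H : ∀ i, Matrix (Fin (n (i + 1))) (Fin (n i)) A,
      ∀ i < k, D (i + 1) * H (i + 1) + H i * D i = y ^ k • (1 : Matrix _ _ A) := by
  induction k with
  | zero => exact ⟨fun _ => 0, by simp⟩
  | succ k ih =>
    obtain ⟨H, hH⟩ := ih fun i hi => h i (by lia)
    have hG := Matrix.mul_smul_one_sub_mul_eq_zero hn hD hH
    obtain ⟨F, hF⟩ := Matrix.exists_mul_eq_smul (h k (by lia)) hG
    refine ⟨Function.update (fun i => y • H i) (k + 1) F, fun i hi => ?_⟩
    rw [Function.update_of_ne (a := i) (by lia)]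
    rcases Nat.lt_succ_iff_lt_or_eq.1 hi with hi | rfl
    · rw [Function.update_of_ne (by lia), Matrix.mul_smul, Matrix.smul_mul, ← smul_add, hH i hi,
        smul_smul, pow_succ']
    · rw [Function.update_self, hF, Matrix.smul_mul, ← smul_add, sub_add_cancel, smul_smul,
        mul_comm y, pow_succ]

/-- A free complex over a local ring with homology in degree `i₀` and exact below admits a
functional on its degree `i₀` term which takes the value `1` on a cycle, and whose values on
boundaries lie in the maximal ideal. -/
theorem Matrix.exists_functional_of_not_exact {A : Type*} [CommRing A] [IsLocalRing A]
    [IsNoetherianRing A] {l m n : Type*} [Fintype l] [Fintype m] [Fintype n] [DecidableEq m]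
    {D : Matrix l m A} {E : Matrix m n A} {H : Matrix m l A}
    (hH : D * (1 - H * D) = 0) (hDE : D * E = 0)
    (h : ∃ v, D.mulVec v = 0 ∧ ∀ w, E.mulVec w ≠ v) :
    ∃ v lam : m → A, D.mulVec v = 0 ∧ lam ⬝ᵥ v = 1 ∧
      ∀ j, (Matrix.vecMul lam E) j ∈ IsLocalRing.maximalIdeal A := by
  classical
  let f := IsLocalRing.residue A
  have hmv : ∀ w, (E.map f).mulVec (f ∘ w) = f ∘ E.mulVec w := fun w => by
    ext i
    exact (f.map_mulVec E w i).symm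
  obtain ⟨v, hv, hvB⟩ : ∃ v, D.mulVec v = 0 ∧ f ∘ v ∉ LinearMap.range (E.map f).mulVecLin := by
    by_contra! hcon
    obtain ⟨v, hv, hvE⟩ := h
    have hle : LinearMap.ker D.mulVecLin ≤ LinearMap.range E.mulVecLin := by
      refine Submodule.le_of_le_smul_of_le_jacobson_bot (I := IsLocalRing.maximalIdeal A)
        (IsNoetherian.noetherian _) (IsLocalRing.jacobson_eq_maximalIdeal _ bot_ne_top).ge ?_
      intro z hz
      obtain ⟨w', hw'⟩ := hcon z hz
      obtain ⟨w, rfl⟩ : ∃ w, f ∘ w = w' :=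
        ⟨fun i => (IsLocalRing.residue_surjective (w' i)).choose,
          funext fun i => (IsLocalRing.residue_surjective (w' i)).choose_spec⟩
      rw [Matrix.mulVecLin_apply, hmv] at hw'
      have hu : z - E.mulVec w ∈ IsLocalRing.maximalIdeal A • (⊤ : Submodule A (m → A)) := by
        rw [Ideal.mem_smul_top_pi_iff]
        intro i
        rw [← IsLocalRing.residue_eq_zero_iff, Pi.sub_apply, map_sub, sub_eq_zero]
        exact (congrFun hw' i).symm
      have hDu : D.mulVec (z - E.mulVec w) = 0 := by
        rw [Matrix.mulVec_sub, Matrix.mulVec_mulVec, hDE, Matrix.zero_mulVec, sub_zero]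
        exact hz
      have hpu : (1 - H * D).mulVecLin (z - E.mulVec w) = z - E.mulVec w := by
        rw [Matrix.mulVecLin_apply, Matrix.sub_mulVec, Matrix.one_mulVec, ← Matrix.mulVec_mulVec,
          hDu, Matrix.mulVec_zero, sub_zero]
      have hu' : z - E.mulVec w ∈ IsLocalRing.maximalIdeal A • LinearMap.ker D.mulVecLin := by
        have := Submodule.mem_map_of_mem (f := (1 - H * D).mulVecLin) hu
        rw [hpu, Submodule.map_smul''] at this
        refine Submodule.smul_mono le_rfl ?_ this
        rintro _ ⟨x, -, rfl⟩
        rw [LinearMap.mem_ker, Matrix.mulVecLin_apply, Matrix.mulVecLin_apply,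
          Matrix.mulVec_mulVec, hH, Matrix.zero_mulVec]
      rw [← add_sub_cancel (E.mulVec w) z]
      exact Submodule.add_mem_sup ⟨w, rfl⟩ hu'
    obtain ⟨w, hw⟩ := hle hv
    exact hvE w hw
  obtain ⟨g, hgv, hgB⟩ := Submodule.exists_dual_map_eq_bot_of_notMem hvB inferInstance
  choose mu hmu using fun i => IsLocalRing.residue_surjective (g (Pi.single i 1))
  have hg : ∀ w, f (mu ⬝ᵥ w) = g (f ∘ w) := fun w => by
    rw [LinearMap.pi_apply_eq_sum_univ g, dotProduct, map_sum]
    refine Finset.sum_congr rfl fun i _ => ?_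
    rw [map_mul, smul_eq_mul, mul_comm]
    congr 1
    exact (hmu i).trans (by congr 1; ext j; simp [Pi.single_apply, eq_comm])
  have hunit : IsUnit (mu ⬝ᵥ v) := by
    rw [← IsLocalRing.residue_ne_zero_iff_isUnit]
    exact (hg v).trans_ne hgv
  obtain ⟨u, hu⟩ := hunit
  refine ⟨v, (↑u⁻¹ : A) • mu, hv, ?_, fun j => ?_⟩
  · rw [smul_dotProduct, ← hu, smul_eq_mul, Units.inv_mul]
  · rw [Matrix.smul_vecMul, Pi.smul_apply, smul_eq_mul]
    refine Ideal.mul_mem_left _ _ ?_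
    rw [← IsLocalRing.residue_eq_zero_iff]
    have h1 : Matrix.vecMul mu E j = mu ⬝ᵥ E.mulVec (Pi.single j 1) := by
      rw [Matrix.mulVec_single_one]
      rfl
    rw [h1]
    refine (hg _).trans ?_
    rw [← hmv]
    exact (Submodule.mem_bot _).1 (hgB ▸ Submodule.mem_map_of_mem (LinearMap.mem_range_self _ _))

/-- The intersection theorem for a complex of free modules given by matrices, placed in degrees
`1, …, s + 1`. -/
theorem Matrix.le_of_isLocalRing_of_not_exact {A : Type} [CommRing A] [IsLocalRing A]
    [IsNoetherianRing A] [Algebra ℚ A] {d s N : ℕ} (hdim : ringKrullDim A = d) {n : ℕ → ℕ}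
    (hn : n 0 = 0) (hns : ∀ i, s + 1 < i → n i = 0)
    {D : ∀ i, Matrix (Fin (n i)) (Fin (n (i + 1))) A} (hD : ∀ i, D i * D (i + 1) = 0)
    (hhom : ∀ a ∈ IsLocalRing.maximalIdeal A ^ N, ∀ i ≤ s, ∀ v, (D i).mulVec v = 0 →
      ∃ w, (D (i + 1)).mulVec w = a • v)
    (hne : ∃ i, ∃ v, (D i).mulVec v = 0 ∧ ∀ w, (D (i + 1)).mulVec w ≠ v) : d ≤ s := by
  classical
  obtain ⟨t, ht, hcard⟩ :=
    (IsLocalRing.maximalIdeal A).exists_finset_card_eq_height_of_isNoetherianRing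
  have hcard' : t.card = d := by
    have := IsLocalRing.maximalIdeal_height_eq_ringKrullDim (R := A)
    rw [hdim, ← hcard] at this
    exact_mod_cast this
  let e : Fin d ≃ t := (t.equivFinOfCardEq hcard').symm
  have hemem : ∀ j, (e j : A) ∈ IsLocalRing.maximalIdeal A := fun j =>
    ht.1.2 (Ideal.subset_span (e j).2)
  let x : Fin d → A := fun j => ((e j : A) ^ (N + 1)) ^ (s + 1)
  have hx : ∀ j, x j ∈ IsLocalRing.maximalIdeal A := fun j =>
    Ideal.pow_mem_of_mem _ (Ideal.pow_mem_of_mem _ (hemem j) _ (by lia)) _ (by lia)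
  have hrad : IsLocalRing.maximalIdeal A ≤ (Ideal.span (Set.range x)).radical := by
    rw [Ideal.radical_eq_sInf]
    refine le_sInf fun p hp => ?_
    have hple := IsLocalRing.le_maximalIdeal hp.2.ne_top
    refine ht.2 ⟨hp.2, Ideal.span_le.2 fun a ha => ?_⟩ hple
    have h1 : x (e.symm ⟨a, ha⟩) ∈ p := hp.1 (Ideal.subset_span ⟨_, rfl⟩)
    have h2 : x (e.symm ⟨a, ha⟩) = (a ^ (N + 1)) ^ (s + 1) := by simp [x]
    rw [h2] at h1
    exact hp.2.mem_of_pow_mem _ (hp.2.mem_of_pow_mem _ h1)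
  obtain ⟨N', hN'⟩ := Ideal.exists_pow_le_of_le_radical_of_fg hrad (IsNoetherian.noetherian _)
  have hhtpy : ∀ j, ∃ H : ∀ i, Matrix (Fin (n (i + 1))) (Fin (n i)) A,
      ∀ i, D (i + 1) * H (i + 1) + H i * D i = x j • (1 : Matrix _ _ A) := by
    intro j
    obtain ⟨H, hH⟩ := Matrix.exists_homotopy_pow hn hD (y := (e j : A) ^ (N + 1)) (s + 1)
      fun i hi => hhom _ (Ideal.pow_le_pow_right (Nat.le_succ N)
        (Ideal.pow_mem_pow (hemem j) _)) i (by lia)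
    refine ⟨H, fun i => ?_⟩
    by_cases hi : i < s + 1
    · exact hH i hi
    · ext l
      exact (hns (i + 1) (by lia) ▸ l).elim0
  choose H hH using hhtpy
  have hi0 := Nat.find_spec hne
  have hlt : ∀ i < Nat.find hne, _ := fun i hi => Nat.find_min hne hi
  generalize Nat.find hne = i0 at hi0 hlt
  obtain ⟨G, hG⟩ := Matrix.exists_homotopy_pow hn hD (y := 1) i0 fun i hi v hv => by
    have := hlt i hi
    push Not at this
    simpa using this v hv
  have hG' := Matrix.mul_smul_one_sub_mul_eq_zero hn hD hG
  rw [one_pow, one_smul] at hG'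
  obtain ⟨v, lam, hv, hlam, hE⟩ := Matrix.exists_functional_of_not_exact hG' (hD i0) hi0
  have hb : ∀ l, ∃ b : Fin d → A,
      ∑ j, b j * x j = (Matrix.vecMul lam (D (i0 + 1))) l ^ N' := fun l =>
    Ideal.mem_span_range_iff_exists_fun.1 (hN' (Ideal.pow_mem_pow (hE l) N'))
  choose b hb using hb
  exact KoszulDatum.le_of_isNoetherianRing hdim hx hN'
    { n := n, n_zero := hn, n_large := hns, D := D, H := H, D_mul := hD, homotopy := hH, i0 := i0
      v := v, lam := lam, N := N', b := b, cycle := hv, lam_v := hlam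
      boundary := fun l => (hb l).symm }

theorem IsFiniteLength.exists_maximalIdeal_pow_smul_eq_zero {A M : Type*} [CommRing A]
    [IsLocalRing A] [AddCommGroup M] [Module A M] (h : IsFiniteLength A M) :
    ∃ N : ℕ, ∀ a ∈ IsLocalRing.maximalIdeal A ^ N, ∀ z : M, a • z = 0 := by
  induction h with
  | of_subsingleton => exact ⟨0, fun a _ z => Subsingleton.elim _ _⟩
  | @of_simple_quotient M _ _ P _ _ ih =>
    obtain ⟨N, hN⟩ := ih
    refine ⟨N + 1, fun a ha z => ?_⟩
    rw [pow_succ] at ha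
    induction ha using Submodule.mul_induction_on' with
    | mem_mul_mem a ha b hb =>
      have hbz : b • z ∈ P := by
        have hmax := IsSimpleModule.annihilator_isMaximal (R := A) (M := M ⧸ P)
        rw [← IsLocalRing.eq_maximalIdeal hmax, Module.mem_annihilator] at hb
        rw [← Submodule.Quotient.mk_eq_zero, Submodule.Quotient.mk_smul]
        exact hb _
      rw [mul_smul]
      exact congrArg Subtype.val (hN a ha ⟨b • z, hbz⟩)
    | add a _ b _ ha hb => rw [add_smul, ha, hb, add_zero]

theorem CategoryTheory.ShortComplex.exists_f_eq_smul {A : Type} [CommRing A]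
    (S : ShortComplex (ModuleCat A)) {a : A} (ha : ∀ h : S.homology, a • h = 0) {z : S.X₂}
    (hz : S.g z = 0) : ∃ w, S.f w = a • z := by
  let q : S.moduleCatLeftHomologyData.H := (LinearMap.range S.moduleCatToCycles).mkQ ⟨z, hz⟩
  have h1 : a • q = 0 := by
    have h2 := congrArg S.moduleCatHomologyIso.hom (ha (S.moduleCatHomologyIso.inv q))
    rw [map_smul, map_zero, Iso.inv_hom_id_apply] at h2
    exact h2
  obtain ⟨w, hw⟩ : a • ⟨z, hz⟩ ∈ LinearMap.range S.moduleCatToCycles := by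
    rw [← Submodule.Quotient.mk_eq_zero, Submodule.Quotient.mk_smul]
    exact h1
  exact ⟨w, congrArg Subtype.val hw⟩

/-- The intersection theorem: if `0 → M_s → ⋯ → M_0 → 0` is a non-exact complex of
finitely generated free modules over a Noetherian local `ℂ`-algebra `A` of Krull
dimension `d`, whose homology modules all have finite length, then `s ≥ d`. -/
theorem intersection_theorem
    (A : Type) [CommRing A] [IsLocalRing A] [IsNoetherianRing A] [Algebra ℂ A]
    (d : ℕ) (hdim : ringKrullDim A = d)
    (s : ℕ) (M : ChainComplex (ModuleCat A) ℕ)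
    (hconc : ∀ i, s < i → IsZero (M.X i))
    (hfree : ∀ i, Module.Finite A (M.X i) ∧ Module.Free A (M.X i))
    (hfl : ∀ i, IsFiniteLength A (M.homology i))
    (hnonexact : ∃ i, ¬ IsZero (M.homology i)) :
    d ≤ s := by
  let : Algebra ℚ A := Algebra.compHom A (algebraMap ℚ ℂ)
  have (i : ℕ) := (hfree i).1
  have (i : ℕ) := (hfree i).2
  let e (i : ℕ) := Module.finBasis A (M.X i)
  let n (i : ℕ) : ℕ := Nat.casesOn i 0 fun i => Module.finrank A (M.X i)
  let D (i : ℕ) : Matrix (Fin (n i)) (Fin (n (i + 1))) A := Nat.casesOn i 0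
    fun i => LinearMap.toMatrix (e (i + 1)) (e i) (M.d (i + 1) i).hom
  have hD1 (i : ℕ) (w : M.X (i + 1)) :
      (D (i + 1)).mulVec ((e (i + 1)).equivFun w) = (e i).equivFun (M.d (i + 1) i w) :=
    LinearMap.toMatrix_mulVec_repr (e (i + 1)) (e i) (M.d (i + 1) i).hom w
  have hcyc (i : ℕ) (z : M.X i) :
      (D i).mulVec ((e i).equivFun z) = 0 ↔ M.d i ((ComplexShape.down ℕ).next i) z = 0 := by
    rcases i with _ | i
    · exact iff_of_true (funext fun j : Fin 0 => j.elim0) (by rw [M.shape _ _ (by simp)]; rfl)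
    · rw [hD1, ChainComplex.next_nat_succ, EmbeddingLike.map_eq_zero_iff]
  choose N hN using fun i => (hfl i).exists_maximalIdeal_pow_smul_eq_zero
  refine Matrix.le_of_isLocalRing_of_not_exact (n := n) (D := D) (s := s)
    (N := (Finset.range (s + 1)).sup N) hdim rfl ?_ ?_ ?_ ?_
  · rintro (_ | i) hi
    · lia
    · have : Subsingleton (M.X i) := ModuleCat.subsingleton_of_isZero (hconc i (by lia))
      exact Module.finrank_zero_of_subsingleton
  · rintro (_ | i)
    · exact Matrix.zero_mul _
    · change LinearMap.toMatrix _ _ _ * LinearMap.toMatrix _ _ _ = 0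
      rw [← LinearMap.toMatrix_comp, ← ModuleCat.hom_comp, M.d_comp_d]
      simp
  · intro a ha i hi v hv
    obtain ⟨z, rfl⟩ := (e i).equivFun.surjective v
    let I := M.homologyIsoSc' (i + 1) i ((ComplexShape.down ℕ).next i) (by simp) rfl
    obtain ⟨w, hw⟩ := (M.sc' (i + 1) i ((ComplexShape.down ℕ).next i)).exists_f_eq_smul (a := a)
      (fun h => by
        rw [← I.inv_hom_id_apply h, ← map_smul, hN i a, map_zero]
        exact Ideal.pow_le_pow_right (Finset.le_sup (by simpa using by lia)) ha)
      ((hcyc i z).1 hv)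
    refine ⟨(e (i + 1)).equivFun w, (hD1 i w).trans ?_⟩
    rw [← map_smul]
    exact congrArg _ hw
  · obtain ⟨i, hi⟩ := hnonexact
    refine ⟨i, ?_⟩
    by_contra hcon
    push Not at hcon
    refine hi ((M.exactAt_iff_isZero_homology i).1 ?_)
    rw [M.exactAt_iff' (i + 1) i ((ComplexShape.down ℕ).next i) (by simp) rfl,
      ShortComplex.moduleCat_exact_iff]
    intro z hz
    obtain ⟨w, hw⟩ := hcon _ ((hcyc i z).2 hz)
    obtain ⟨w, rfl⟩ := (e (i + 1)).equivFun.surjective w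
    exact ⟨w, (e i).equivFun.injective ((hD1 i w).symm.trans hw)⟩
end
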